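/- arXiv:2408.12543 — 7 statements merged into one kernel-verified Lean document; each statement's English description precedes it below -/
import Mathlib

section
/- Let R be a commutative ring, let m ≥ 1, and let h : ℤ → R satisfy h(0) = 1 and h(j) = 0 for j < 0. Let M be the m×m matrix with entries M_{i,j} = h(i − j + 1) for 1 ≤ i, j ≤ m (so M has h(1) on the diagonal, h(0) = 1 on the superdiagonal, and vanishes above the superdiagonal). Then det M = Σ_α (−1)^{z(α)} ∏_{i=1}^m h(α_i), where the sum is over all allowable contents α of length m and z(α) denotes the number of zero entries of α. -/
open scoped Classical

/-- An *allowable content* of length `m`: a tuple `α = (α_0, …, α_{m-1})` of integers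
with `0 ≤ α i ≤ m`, first entry positive, and such that each positive entry `t` is
immediately followed by exactly `t - 1` zeros before the next positive entry or the
end of the tuple. -/
def AllowableContent (m : ℕ) (α : Fin m → ℕ) : Prop :=
  (∀ i, α i ≤ m) ∧
  (∀ h0 : 0 < m, 0 < α ⟨0, h0⟩) ∧
  ∀ i : Fin m, 0 < α i →
    (i : ℕ) + α i ≤ m ∧
    (∀ j : Fin m, (i : ℕ) < (j : ℕ) → (j : ℕ) < (i : ℕ) + α i → α j = 0) ∧
    ∀ hj : (i : ℕ) + α i < m, 0 < α ⟨(i : ℕ) + α i, hj⟩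

theorem allowableContent_succ_iff (n : ℕ) (α : Fin (n + 1) → ℕ) :
    AllowableContent (n + 1) α ↔ 0 < α 0 ∧ ∀ i : Fin (n + 1), 0 < α i →
      (i : ℕ) + α i ≤ n + 1 ∧ ∀ j : Fin (n + 1), (i : ℕ) < j →
        ((j : ℕ) < i + α i → α j = 0) ∧ ((j : ℕ) = i + α i → 0 < α j) := by
  constructor
  · rintro ⟨-, hpos, hblock⟩
    refine ⟨hpos n.succ_pos, fun i hi => ⟨(hblock i hi).1, fun j hij =>
      ⟨(hblock i hi).2.1 j hij, fun hj => ?_⟩⟩⟩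
    have hlt : (i : ℕ) + α i < n + 1 := hj ▸ j.isLt
    have hj' : j = ⟨(i : ℕ) + α i, hlt⟩ := Fin.ext hj
    rw [hj']
    exact (hblock i hi).2.2 hlt
  · rintro ⟨hpos, hblock⟩
    refine ⟨fun i => ?_, fun _ => hpos, fun i hi => ⟨(hblock i hi).1,
      fun j hij => ((hblock i hi).2 j hij).1, fun hj => ?_⟩⟩
    · rcases Nat.eq_zero_or_pos (α i) with hi | hi
      · omega
      · have := (hblock i hi).1
        omega
    · exact ((hblock i hi).2 ⟨_, hj⟩ (Nat.lt_add_of_pos_right hi)).2 rfl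

/-- Prepending a one to a content. -/
def consOne {n : ℕ} (α : Fin (n + 1) → ℕ) : Fin (n + 2) → ℕ :=
  Fin.cons 1 α

/-- Increasing the first entry of a content and inserting a zero after it. -/
def growHead {n : ℕ} (α : Fin (n + 1) → ℕ) : Fin (n + 2) → ℕ :=
  Fin.cons (α 0 + 1) (Fin.cons 0 (Fin.tail α))

theorem consOne_injective {n : ℕ} : Function.Injective (consOne (n := n)) :=
  Fin.cons_right_injective (α := fun _ => ℕ) 1

theorem growHead_injective {n : ℕ} : Function.Injective (growHead (n := n)) := by
  intro α β hαβ
  obtain ⟨hhead, htail⟩ := Fin.cons_inj.1 hαβ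
  rw [← Fin.cons_self_tail α, ← Fin.cons_self_tail β, (Fin.cons_inj.1 htail).2,
    Nat.succ_injective hhead]

theorem allowableContent_consOne {n : ℕ} (α : Fin (n + 1) → ℕ) :
    AllowableContent (n + 2) (consOne α) ↔ AllowableContent (n + 1) α := by
  rw [allowableContent_succ_iff, allowableContent_succ_iff]
  simp only [consOne, Fin.forall_fin_succ (n := n + 1), Fin.cons_zero, Fin.cons_succ,
    Fin.val_zero, Fin.val_succ]
  constructor
  · rintro ⟨-, h0, hs⟩
    refine ⟨((h0 one_pos).2.2 0 (by simp)).2 (by simp), fun i hi => ?_⟩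
    refine ⟨by have := (hs i hi).1; omega, fun j hij => ?_⟩
    have := (hs i hi).2.2 j (by omega)
    exact ⟨fun h => this.1 (by omega), fun h => this.2 (by omega)⟩
  · rintro ⟨h0, hs⟩
    refine ⟨one_pos, fun _ => ⟨by omega, by omega, fun j _ => ⟨by omega, fun hj => ?_⟩⟩,
      fun i hi => ⟨by have := (hs i hi).1; omega, by omega, fun j hij => ?_⟩⟩
    · have hj' : j = 0 := Fin.ext (show (j : ℕ) = 0 by omega)
      rwa [hj']
    · have := (hs i hi).2 j (by omega)
      exact ⟨fun h => this.1 (by omega), fun h => this.2 (by omega)⟩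

theorem allowableContent_growHead {n : ℕ} (α : Fin (n + 1) → ℕ) (hα : 0 < α 0) :
    AllowableContent (n + 2) (growHead α) ↔ AllowableContent (n + 1) α := by
  rw [allowableContent_succ_iff, allowableContent_succ_iff]
  simp only [growHead, Fin.forall_fin_succ, Fin.cons_zero, Fin.cons_succ,
    Fin.val_zero, Fin.val_succ, Fin.tail]
  constructor
  · rintro ⟨-, h0, -, hs⟩
    refine ⟨hα, fun _ => ⟨by have := (h0 (by omega)).1; omega, by omega, fun j hj => ?_⟩,
      fun i hi => ⟨by have := (hs i hi).1; omega, by omega, fun j hij => ?_⟩⟩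
    · have := (h0 (by omega)).2.2.2 j (by omega)
      exact ⟨fun h => this.1 (by omega), fun h => this.2 (by omega)⟩
    · have := (hs i hi).2.2.2 j (by omega)
      exact ⟨fun h => this.1 (by omega), fun h => this.2 (by omega)⟩
  · rintro ⟨-, h0, hs⟩
    refine ⟨by omega, fun _ => ⟨by have := (h0 hα).1; omega, fun hlt => absurd hlt (lt_irrefl 0),
      fun _ => ⟨fun _ => trivial, by omega⟩, fun j hj => ?_⟩,
      fun hlt => absurd hlt (lt_irrefl 0),
      fun i hi => ⟨by have := (hs i hi).1; omega, by omega, by omega, fun j hij => ?_⟩⟩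
    · have := (h0 hα).2.2 j (by omega)
      exact ⟨fun h => this.1 (by omega), fun h => this.2 (by omega)⟩
    · have := (hs i hi).2.2 j (by omega)
      exact ⟨fun h => this.1 (by omega), fun h => this.2 (by omega)⟩

/-- The finite set of allowable contents of length `n + 1`, built recursively. -/
noncomputable def contents : (n : ℕ) → Finset (Fin (n + 1) → ℕ)
  | 0 => {fun _ => 1}
  | n + 1 => (contents n).image consOne ∪ (contents n).image growHead

theorem mem_contents {n : ℕ} (α : Fin (n + 1) → ℕ) :
    α ∈ contents n ↔ AllowableContent (n + 1) α := by
  induction n with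
  | zero =>
    rw [allowableContent_succ_iff, contents, Finset.mem_singleton, funext_iff]
    constructor
    · intro hα
      refine ⟨by simp [hα], fun i _ => ⟨by have := hα i; omega, fun j hij => by omega⟩⟩
    · rintro ⟨hpos, hblock⟩ i
      have := (hblock 0 hpos).1
      rw [Subsingleton.elim (α := Fin 1) i 0]
      omega
  | succ n ih =>
    simp only [contents, Finset.mem_union, Finset.mem_image, ih]
    constructor
    · rintro (⟨β, hβ, rfl⟩ | ⟨β, hβ, rfl⟩)
      · exact (allowableContent_consOne β).2 hβ
      · exact (allowableContent_growHead β (hβ.2.1 n.succ_pos)).2 hβ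
    · intro hα
      obtain ⟨hpos, hblock⟩ := (allowableContent_succ_iff _ α).1 hα
      rcases Nat.lt_or_ge 1 (α 0) with hlt | hle
      · right
        have h1 : α 1 = 0 := ((hblock 0 hpos).2 1 (by simp)).1 (by simpa using hlt)
        have hgrow : growHead (Fin.cons (α 0 - 1) (Fin.tail (Fin.tail α))) = α := by
          funext i
          refine Fin.cases ?_ (fun i => Fin.cases ?_ (fun i => ?_) i) i
          · simp only [growHead, Fin.cons_zero]
            omega
          · simpa [growHead] using h1.symm
          · simp [growHead, Fin.tail]
        refine ⟨_, (allowableContent_growHead _ ?_).1 (hgrow.symm ▸ hα), hgrow⟩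
        simp only [Fin.cons_zero]
        omega
      · left
        have hcons : consOne (Fin.tail α) = α := by
          have hone : α 0 = 1 := by omega
          exact (congrArg (fun a => (Fin.cons a (Fin.tail α) : Fin (n + 2) → ℕ)) hone).symm.trans
            (Fin.cons_self_tail α)
        exact ⟨_, (allowableContent_consOne _).1 (hcons.symm ▸ hα), hcons⟩

theorem disjoint_image_consOne_growHead (n : ℕ) :
    Disjoint ((contents n).image consOne) ((contents n).image growHead) := by
  simp only [Finset.disjoint_left, Finset.mem_image, mem_contents]
  rintro _ ⟨β, -, rfl⟩ ⟨γ, hγ, hβγ⟩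
  have hhead : γ 0 + 1 = 1 := congrFun hβγ 0
  have hpos : 0 < γ 0 := hγ.2.1 n.succ_pos
  omega

section Weight

variable {R : Type*} [CommRing R]

/-- The signed weight of a content, with the first argument of `h` shifted by `c`. -/
noncomputable def shiftedWeight (h : ℤ → R) (c : ℤ) {n : ℕ} (α : Fin (n + 1) → ℕ) : R :=
  (-1) ^ (Finset.univ.filter fun i => α i = 0).card *
    (h (α 0 + c) * ∏ i : Fin n, h (α i.succ))

theorem shiftedWeight_consOne (h : ℤ → R) (c : ℤ) {n : ℕ} (α : Fin (n + 1) → ℕ) :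
    shiftedWeight h c (consOne α) = h (1 + c) * shiftedWeight h 0 α := by
  simp only [shiftedWeight, Finset.card_filter]
  simp only [consOne, Fin.sum_univ_succ (n := n + 1),
    Fin.cons_zero, Fin.cons_succ, Fin.prod_univ_succ (n := n), one_ne_zero, if_false, zero_add,
    add_zero, Nat.cast_one]
  ring

theorem shiftedWeight_growHead (h : ℤ → R) (h0 : h 0 = 1) (c : ℤ) {n : ℕ}
    (α : Fin (n + 1) → ℕ) (hα : 0 < α 0) :
    shiftedWeight h c (growHead α) = -shiftedWeight h (c + 1) α := by
  have hshift : ((α 0 + 1 : ℕ) : ℤ) + c = α 0 + (c + 1) := by push_cast; ring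
  simp only [shiftedWeight, Finset.card_filter]
  simp only [growHead, Fin.sum_univ_succ,
    Fin.cons_zero, Fin.cons_succ, Fin.prod_univ_succ (n := n), Fin.tail, hshift, Nat.cast_zero, h0,
    hα.ne', Nat.succ_ne_zero, if_true, if_false, zero_add, pow_add]
  ring

theorem sum_shiftedWeight_succ (h : ℤ → R) (h0 : h 0 = 1) (c : ℤ) (n : ℕ) :
    ∑ α ∈ contents (n + 1), shiftedWeight h c α =
      h (1 + c) * ∑ α ∈ contents n, shiftedWeight h 0 α -
        ∑ α ∈ contents n, shiftedWeight h (c + 1) α := by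
  rw [contents, Finset.sum_union (disjoint_image_consOne_growHead n),
    Finset.sum_image consOne_injective.injOn, Finset.sum_image growHead_injective.injOn,
    Finset.mul_sum, sub_eq_add_neg, ← Finset.sum_neg_distrib]
  congr 1
  · exact Finset.sum_congr rfl fun α _ => shiftedWeight_consOne h c α
  · exact Finset.sum_congr rfl fun α hα =>
      shiftedWeight_growHead h h0 c α (((mem_contents α).1 hα).2.1 n.succ_pos)

/-- The matrix `h (i - j + 1)` with the arguments in its first column shifted by `c`. -/
def shiftedMatrix (h : ℤ → R) (c : ℤ) (n : ℕ) : Matrix (Fin (n + 1)) (Fin (n + 1)) R :=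
  Matrix.of fun i => Fin.cons (h (i + 1 + c)) fun j => h ((i : ℤ) - j)

theorem det_shiftedMatrix_succ (h : ℤ → R) (h0 : h 0 = 1) (hneg : ∀ j : ℤ, j < 0 → h j = 0)
    (c : ℤ) (n : ℕ) :
    (shiftedMatrix h c (n + 1)).det =
      h (1 + c) * (shiftedMatrix h 0 n).det - (shiftedMatrix h (c + 1) n).det := by
  have hfst : (shiftedMatrix h c (n + 1)).submatrix Fin.succ (Fin.succAbove 0) =
      shiftedMatrix h 0 n := by
    ext i j
    refine Fin.cases ?_ (fun j => ?_) j <;> simp [shiftedMatrix]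
  have hsnd : (shiftedMatrix h c (n + 1)).submatrix Fin.succ (Fin.succAbove (Fin.succ 0)) =
      shiftedMatrix h (c + 1) n := by
    ext i j
    refine Fin.cases ?_ (fun j => ?_) j
    · simp only [shiftedMatrix, Matrix.submatrix_apply, Matrix.of_apply, Fin.succ_succAbove_zero,
        Fin.cons_zero, Fin.val_succ]
      congr 1
      push_cast
      ring
    · simp [shiftedMatrix]
  rw [Matrix.det_succ_row_zero, Fin.sum_univ_succ, Fin.sum_univ_succ, hfst, hsnd,
    Finset.sum_eq_zero fun j _ => ?_]
  · simp [shiftedMatrix, h0, sub_eq_add_neg]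
  · have hzero : shiftedMatrix h c (n + 1) 0 j.succ.succ = 0 := by
      simp only [shiftedMatrix, Matrix.of_apply, Fin.cons_succ]
      exact hneg _ (by simp; omega)
    rw [hzero, mul_zero, zero_mul]

theorem det_shiftedMatrix (h : ℤ → R) (h0 : h 0 = 1) (hneg : ∀ j : ℤ, j < 0 → h j = 0)
    (c : ℤ) (n : ℕ) :
    (shiftedMatrix h c n).det = ∑ α ∈ contents n, shiftedWeight h c α := by
  induction n generalizing c with
  | zero => simp [shiftedMatrix, contents, shiftedWeight]
  | succ n ih => rw [det_shiftedMatrix_succ h h0 hneg, sum_shiftedWeight_succ h h0, ih, ih]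

end Weight

/-- the determinant of the `m × m` matrix with entries `h (i - j + 1)`
(where `h 0 = 1` and `h j = 0` for `j < 0`) equals the signed sum over allowable
contents `α` of `(-1)^{#zeros of α} ∏ i, h (α i)`. -/
theorem stmt0 (R : Type*) [CommRing R] (m : ℕ) (hm : 1 ≤ m) (h : ℤ → R)
    (h0 : h 0 = 1) (hneg : ∀ j : ℤ, j < 0 → h j = 0) :
    (Matrix.of fun i j : Fin m => h (((i : ℕ) : ℤ) - ((j : ℕ) : ℤ) + 1)).det =
      ∑ α ∈ (Finset.univ : Finset (Fin m → Fin (m + 1))).filter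
          (fun α => AllowableContent m fun i => (α i : ℕ)),
        (-1 : R) ^ ((Finset.univ : Finset (Fin m)).filter fun i => (α i : ℕ) = 0).card *
          ∏ i : Fin m, h ((α i : ℕ) : ℤ) := by
  obtain ⟨n, rfl⟩ : ∃ n, m = n + 1 := ⟨m - 1, by omega⟩
  have hmat : (Matrix.of fun i j : Fin (n + 1) => h (((i : ℕ) : ℤ) - ((j : ℕ) : ℤ) + 1)) =
      shiftedMatrix h 0 n := by
    ext i j
    refine Fin.cases ?_ (fun j => ?_) j
    · simp [shiftedMatrix]
    · simp only [shiftedMatrix, Matrix.of_apply, Fin.cons_succ, Fin.val_succ]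
      congr 1
      push_cast
      ring
  rw [hmat, det_shiftedMatrix h h0 hneg]
  symm
  refine Finset.sum_bij (fun α _ i => (α i : ℕ)) (fun α hα => ?_) (fun α _ β _ hαβ => ?_)
    (fun α hα => ?_) (fun α _ => ?_)
  · exact (mem_contents _).2 (Finset.mem_filter.1 hα).2
  · exact funext fun i => Fin.ext (congrFun hαβ i)
  · have hallow := (mem_contents α).1 hα
    exact ⟨fun i => ⟨α i, Nat.lt_succ_of_le (hallow.1 i)⟩,
      Finset.mem_filter.2 ⟨Finset.mem_univ _, hallow⟩, rfl⟩
  · rw [shiftedWeight, Fin.prod_univ_succ, add_zero]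
end

section
/- For every integer m ≥ 1 there exists a map φ on the set W_m of words of length m over the alphabet {1,…,m} whose content is an allowable content, such that: (1) φ maps W_m into W_m and is an involution; (2) the word 1 2 ⋯ m is the unique fixed point of φ; (3) for every non-fixed word w, the number of zero entries of the content of φ(w) differs from the number of zero entries of the content of w by exactly 1 (so φ reverses the sign (−1)^{number of zero entries}); and (4) φ preserves the number of tied inversions of the word. -/
open scoped Classical

/-- The content of a word `w` of length `m` over the alphabet `{1, …, m}`:
`contentOf m w i` is the number of occurrences of the letter `i + 1` in `w`. -/
def contentOf (m : ℕ) (w : Fin m → ℕ) : Fin m → ℕ := fun i =>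
  (Finset.univ.filter fun p => w p = (i : ℕ) + 1).card

/-- A word of length `m` over `{1, …, m}` whose content is an allowable content. -/
def IsAllowableWord (m : ℕ) (w : Fin m → ℕ) : Prop :=
  (∀ p, 1 ≤ w p ∧ w p ≤ m) ∧ AllowableContent m (contentOf m w)

/-- Number of tied inversions of `w`: pairs of positions `p < q` with `w p ≥ w q`. -/
def tiedInvW (m : ℕ) (w : Fin m → ℕ) : ℕ :=
  ((Finset.univ ×ˢ Finset.univ : Finset (Fin m × Fin m)).filter fun pq =>
    pq.1 < pq.2 ∧ w pq.2 ≤ w pq.1).card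

/-- Number of zero entries of the content of `w`. -/
def zerosW (m : ℕ) (w : Fin m → ℕ) : ℕ :=
  (Finset.univ.filter fun i => contentOf m w i = 0).card

namespace AllowableWord

variable {m : ℕ}

/-- The number of occurrences of the letter `v` in `w`. -/
def letterCount (w : Fin m → ℕ) (v : ℕ) : ℕ :=
  (Finset.univ.filter fun p => w p = v).card

theorem letterCount_pos {w : Fin m → ℕ} {v : ℕ} : 0 < letterCount w v ↔ ∃ p, w p = v := by
  simp [letterCount, Finset.card_pos, Finset.Nonempty]

theorem letterCount_le (w : Fin m → ℕ) (v : ℕ) : letterCount w v ≤ m := by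
  simpa [letterCount] using Finset.card_filter_le Finset.univ fun p => w p = v

theorem one_lt_letterCount {w : Fin m → ℕ} {v : ℕ} :
    1 < letterCount w v ↔ ∃ q p, q < p ∧ w q = v ∧ w p = v := by
  simp only [letterCount, Finset.one_lt_card, Finset.mem_filter, Finset.mem_univ, true_and]
  constructor
  · rintro ⟨a, ha, b, hb, hab⟩
    rcases lt_or_gt_of_ne hab with h | h
    exacts [⟨a, b, h, ha, hb⟩, ⟨b, a, h, hb, ha⟩]
  · rintro ⟨a, b, h, ha, hb⟩
    exact ⟨a, ha, b, hb, h.ne⟩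

/-- Allowability of a word, with the content indexed by letters instead of by `Fin m`. -/
theorem isAllowableWord_iff (hm : 1 ≤ m) (w : Fin m → ℕ) :
    IsAllowableWord m w ↔ (∀ p, 1 ≤ w p ∧ w p ≤ m) ∧ 0 < letterCount w 1 ∧
      ∀ v, 0 < letterCount w v → v + letterCount w v ≤ m + 1 ∧
        (∀ u, v < u → u < v + letterCount w v → letterCount w u = 0) ∧
        (v + letterCount w v ≤ m → 0 < letterCount w (v + letterCount w v)) := by
  have key : ∀ i : Fin m, contentOf m w i = letterCount w (i + 1) := fun i => rfl
  unfold IsAllowableWord AllowableContent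
  simp only [key]
  refine and_congr_right fun hw => ?_
  constructor
  · rintro ⟨-, h0, h⟩
    refine ⟨h0 hm, fun v hv => ?_⟩
    obtain ⟨p, rfl⟩ := letterCount_pos.1 hv
    obtain ⟨v, hv'⟩ : ∃ v, w p = v + 1 := ⟨w p - 1, by have := hw p; omega⟩
    have hvm : v < m := by have := hw p; omega
    rw [hv'] at hv ⊢
    obtain ⟨h1, h2, h3⟩ := h ⟨v, hvm⟩ hv
    simp only at h1 h2 h3
    refine ⟨by omega, fun u hu hu' => ?_, fun hle => ?_⟩
    · have := h2 ⟨u - 1, by omega⟩ (by simp only; omega) (by simp only; omega)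
      simpa [Nat.sub_add_cancel (show 1 ≤ u by omega)] using this
    · have := h3 (by omega)
      rwa [show v + letterCount w (v + 1) + 1 = v + 1 + letterCount w (v + 1) by omega] at this
  · rintro ⟨h0, h⟩
    refine ⟨fun i => letterCount_le w _, fun _ => h0, fun i hi => ?_⟩
    obtain ⟨h1, h2, h3⟩ := h _ hi
    refine ⟨by omega, fun j hj hj' => h2 _ (by omega) (by omega), fun hj => ?_⟩
    have := h3 (by omega)
    rwa [show (i : ℕ) + 1 + letterCount w (i + 1) = i + letterCount w (i + 1) + 1 by omega] at this

/-- `w'` arises from `w`, which has no letter `i + 1`, by keeping the last of at least two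
occurrences of `i` and raising all the others to `i + 1`. -/
def IsSplit (i : ℕ) (w w' : Fin m → ℕ) : Prop :=
  ∃ p, w p = i ∧ w' p = i ∧ (∃ q, q < p ∧ w q = i) ∧ (∀ q, w q ≠ i + 1) ∧
    ∀ q, q ≠ p → (w q = i → q < p ∧ w' q = i + 1) ∧ (w q ≠ i → w' q = w q)

/-- Some letter `i` is followed, when the positions are listed by increasing letter and by
decreasing position within a letter, by a smaller position. -/
def HasDescent (w : Fin m → ℕ) (i : ℕ) : Prop :=
  (∃ q p, q < p ∧ w q = i ∧ w p = i) ∨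
    ∃ p, w p = i ∧ (∃ q, w q = i + 1) ∧ ∀ q, w q = i + 1 → q < p

/-- Raise every occurrence of `i` except the last one. -/
noncomputable def splitLetter (i : ℕ) (w : Fin m → ℕ) : Fin m → ℕ := fun q =>
  if w q = i ∧ ∃ r, q < r ∧ w r = i then i + 1 else w q

/-- Replace every occurrence of `i + 1` by `i`. -/
def mergeLetter (i : ℕ) (w : Fin m → ℕ) : Fin m → ℕ := fun q =>
  if w q = i + 1 then i else w q

/-- Split the letter `i` if it is repeated, otherwise merge `i + 1` into it. -/
noncomputable def toggle (i : ℕ) (w : Fin m → ℕ) : Fin m → ℕ :=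
  if ∃ q p, q < p ∧ w q = i ∧ w p = i then splitLetter i w else mergeLetter i w

/-- Toggle at the first descent. -/
noncomputable def descentToggle (w : Fin m → ℕ) : Fin m → ℕ :=
  if h : ∃ i, HasDescent w i then toggle (Nat.find h) w else w

theorem isSplit_splitLetter {i : ℕ} {w : Fin m → ℕ} (h : ∃ q p, q < p ∧ w q = i ∧ w p = i)
    (hi : ∀ q, w q ≠ i + 1) : IsSplit i w (splitLetter i w) := by
  obtain ⟨q, r, hqr, hq, hr⟩ := h
  obtain ⟨p, hp, hmax⟩ := Finset.exists_max_image (Finset.univ.filter fun p => w p = i) id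
    ⟨q, by simpa using hq⟩
  simp only [Finset.mem_filter, Finset.mem_univ, true_and, id] at hp hmax
  refine ⟨p, hp, ?_, ⟨q, hqr.trans_le (hmax r hr), hq⟩, hi, fun s hs =>
    ⟨fun hsi => ?_, fun hsi => ?_⟩⟩
  · have : ¬ ∃ r, p < r ∧ w r = i := by
      rintro ⟨r, h1, h2⟩
      exact absurd (hmax r h2) (not_le.2 h1)
    simp [splitLetter, this, hp]
  · have hlt := lt_of_le_of_ne (hmax s hsi) hs
    exact ⟨hlt, if_pos ⟨hsi, p, hlt, hp⟩⟩
  · simp [splitLetter, hsi]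

theorem isSplit_mergeLetter {i : ℕ} {w : Fin m → ℕ} (h : ¬ ∃ q p, q < p ∧ w q = i ∧ w p = i)
    (hd : HasDescent w i) : IsSplit i (mergeLetter i w) w := by
  obtain ⟨p, hp, ⟨q, hq⟩, hlt⟩ := hd.resolve_left h
  have huniq : ∀ s, w s = i → s = p := by
    intro s hs
    by_contra hne
    rcases lt_or_gt_of_ne hne with h' | h'
    exacts [h ⟨s, p, h', hs, hp⟩, h ⟨p, s, h', hp, hs⟩]
  refine ⟨p, by simp [mergeLetter, hp], hp, ⟨q, hlt q hq, by simp [mergeLetter, hq]⟩, ?_, ?_⟩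
  · intro s
    unfold mergeLetter
    split_ifs <;> omega
  · intro s hs
    have := huniq s
    have := hlt s
    unfold mergeLetter
    split_ifs <;> grind

namespace IsSplit

variable {i : ℕ} {w w' : Fin m → ℕ}

theorem repeated (h : IsSplit i w w') : ∃ q p, q < p ∧ w q = i ∧ w p = i := by
  obtain ⟨p, hp, -, ⟨q, hq, hq'⟩, -⟩ := h
  exact ⟨q, p, hq, hq', hp⟩

theorem not_repeated (h : IsSplit i w w') : ¬ ∃ q p, q < p ∧ w' q = i ∧ w' p = i := by
  obtain ⟨p, hp, hp', -, -, h⟩ := h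
  rintro ⟨a, b, hab, ha, hb⟩
  have h1 := h a
  have h2 := h b
  grind

theorem toggle_left (h : IsSplit i w w') : toggle i w = w' := by
  rw [toggle, if_pos h.repeated]
  obtain ⟨p, hp, hp', -, -, h⟩ := h
  ext q
  unfold splitLetter
  have h1 := h q
  split_ifs with hc
  · obtain ⟨h2, r, h3, h4⟩ := hc
    have h5 := h r
    grind
  · grind

theorem toggle_right (h : IsSplit i w w') : toggle i w' = w := by
  rw [toggle, if_neg h.not_repeated]
  obtain ⟨p, hp, hp', -, hne, h⟩ := h
  ext q
  unfold mergeLetter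
  have h1 := h q
  have h2 := hne q
  grind

theorem hasDescent_left (h : IsSplit i w w') : HasDescent w i := Or.inl h.repeated

theorem hasDescent_right (h : IsSplit i w w') : HasDescent w' i := by
  obtain ⟨p, hp, hp', ⟨r, hr, hr'⟩, hne, h⟩ := h
  refine Or.inr ⟨p, hp', ⟨r, ((h r hr.ne).1 hr').2⟩, fun q hq => ?_⟩
  have h1 := h q
  have h2 := hne q
  grind

theorem hasDescent_iff (h : IsSplit i w w') {j : ℕ} (hj : j < i) :
    HasDescent w j ↔ HasDescent w' j := by
  obtain ⟨p, hp, hp', -, hne, h⟩ := h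
  have hsame : ∀ q v, v < i → (w q = v ↔ w' q = v) := by
    intro q v hv
    have h1 := h q
    grind
  unfold HasDescent
  simp only [hsame _ j hj]
  refine or_congr_right (exists_congr fun r => and_congr_right fun _ => ?_)
  rcases (show j + 1 ≤ i from hj).lt_or_eq with hlt | rfl
  · simp only [hsame _ _ hlt]
  · refine and_congr ⟨fun _ => ⟨p, hp'⟩, fun _ => ⟨p, hp⟩⟩ ⟨fun hr q hq => ?_, fun hr q hq => ?_⟩
    · have h1 := h q
      have h2 := hr q
      grind
    · have h1 := h q
      have h2 := hr p hp'
      grind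

theorem letterCount_right_self (h : IsSplit i w w') : letterCount w' i = 1 := by
  obtain ⟨p, hp, hp', -, hne, h⟩ := h
  refine Finset.card_eq_one.2 ⟨p, ?_⟩
  ext q
  have h1 := h q
  simp only [Finset.mem_filter, Finset.mem_univ, true_and, Finset.mem_singleton]
  grind

theorem letterCount_left_succ (h : IsSplit i w w') : letterCount w (i + 1) = 0 := by
  obtain ⟨p, hp, hp', -, hne, h⟩ := h
  simpa [letterCount] using hne

theorem letterCount_right_succ (h : IsSplit i w w') :
    letterCount w' (i + 1) + 1 = letterCount w i := by
  obtain ⟨p, hp, hp', -, hne, h⟩ := h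
  have : (Finset.univ.filter fun q => w' q = i + 1) =
      (Finset.univ.filter fun q => w q = i).erase p := by
    ext q
    have h1 := h q
    have h2 := hne q
    simp only [Finset.mem_filter, Finset.mem_univ, true_and, Finset.mem_erase]
    grind
  rw [letterCount, this, Finset.card_erase_add_one (by simpa using hp), letterCount]

theorem letterCount_of_ne (h : IsSplit i w w') {v : ℕ} (hv : v ≠ i) (hv' : v ≠ i + 1) :
    letterCount w' v = letterCount w v := by
  obtain ⟨p, hp, hp', -, hne, h⟩ := h
  unfold letterCount
  congr 1
  ext q
  have h1 := h q
  simp only [Finset.mem_filter, Finset.mem_univ, true_and]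
  grind

theorem zerosW_eq (h : IsSplit i w w') (him : i + 1 ≤ m) :
    zerosW m w = zerosW m w' + 1 := by
  have hrep := one_lt_letterCount.2 h.repeated
  have h1 := h.letterCount_right_self
  have h2 := h.letterCount_left_succ
  have h3 := h.letterCount_right_succ
  have key : ∀ (w : Fin m → ℕ) (j : Fin m), contentOf m w j = letterCount w (j + 1) :=
    fun _ _ => rfl
  have : (Finset.univ.filter fun j => contentOf m w' j = 0) =
      (Finset.univ.filter fun j => contentOf m w j = 0).erase ⟨i, him⟩ := by
    ext j
    simp only [key, Finset.mem_filter, Finset.mem_univ, true_and, Finset.mem_erase, ne_eq,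
      Fin.ext_iff]
    rcases eq_or_ne (j + 1 : ℕ) i with hj | hj
    · rw [hj]; omega
    rcases eq_or_ne (j : ℕ) i with hj' | hj'
    · rw [hj']; omega
    · rw [h.letterCount_of_ne hj (by omega)]
      simp [hj']
  rw [zerosW, zerosW, this, Finset.card_erase_add_one]
  simpa [key] using h2

theorem tiedInvW_eq (h : IsSplit i w w') : tiedInvW m w = tiedInvW m w' := by
  obtain ⟨p, hp, hp', -, hne, h⟩ := h
  unfold tiedInvW
  congr 1
  ext ⟨a, b⟩
  simp only [Finset.mem_filter, Finset.mem_product, Finset.mem_univ, true_and]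
  refine and_congr_right fun hab => ?_
  have := h a
  have := h b
  have := hne a
  have := hne b
  grind

theorem isAllowableWord_iff (h : IsSplit i w w') (hm : 1 ≤ m) :
    IsAllowableWord m w ↔ IsAllowableWord m w' := by
  have hrep := one_lt_letterCount.2 h.repeated
  have h1 := h.letterCount_right_self
  have h2 := h.letterCount_left_succ
  have h3 := h.letterCount_right_succ
  have h4 := fun v => h.letterCount_of_ne (v := v)
  rw [AllowableWord.isAllowableWord_iff hm, AllowableWord.isAllowableWord_iff hm]
  constructor
  · rintro ⟨hw, h0, hc⟩
    obtain ⟨c1, c2, c3⟩ := hc i (by omega)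
    refine ⟨fun q => ?_, ?_, fun v hv => ?_⟩
    · obtain ⟨p, hp, hp', -, hne, h⟩ := h
      have := h q
      have := hw q
      grind
    · grind
    · by_cases hvi : v = i
      · subst hvi
        refine ⟨by omega, by omega, fun _ => ?_⟩
        rw [h1]; omega
      by_cases hvi' : v = i + 1
      · subst hvi'
        rw [show i + 1 + letterCount w' (i + 1) = i + letterCount w i by omega]
        refine ⟨by omega, fun u hu hu' => ?_, fun hle => ?_⟩
        · rw [h4 u (by omega) (by omega)]
          exact c2 u (by omega) hu'
        · rw [h4 _ (by omega) (by omega)]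
          exact c3 hle
      · rw [h4 v hvi hvi'] at hv ⊢
        obtain ⟨d1, d2, d3⟩ := hc v hv
        refine ⟨d1, fun u hu hu' => ?_, fun hle => ?_⟩
        · have hu0 := d2 u hu hu'
          have hui : u ≠ i := by rintro rfl; omega
          have hui' : u ≠ i + 1 := by
            intro hui'
            have := d2 i (by omega) (by omega)
            omega
          rwa [h4 u hui hui']
        · have hpos := d3 hle
          generalize v + letterCount w v = u at hpos
          have hui' : u ≠ i + 1 := by rintro rfl; omega
          by_cases hui : u = i
          · rw [hui]; omega
          · rwa [h4 u hui hui']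
  · rintro ⟨hw, h0, hc⟩
    obtain ⟨c1, c2, c3⟩ := hc (i + 1) (by omega)
    rw [show i + 1 + letterCount w' (i + 1) = i + letterCount w i by omega] at c1 c2 c3
    refine ⟨fun q => ?_, ?_, fun v hv => ?_⟩
    · obtain ⟨p, hp, hp', -, hne, h⟩ := h
      have := h q
      have := hw q
      have := hw p
      grind
    · by_cases hi : i = 1
      · grind
      by_cases hi : i = 0
      · obtain ⟨p, hp⟩ := letterCount_pos.1 (show 0 < letterCount w' i by omega)
        have := hw p
        omega
      rwa [← h4 1 (by omega) (by omega)]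
    · have hvi' : v ≠ i + 1 := by rintro rfl; omega
      by_cases hvi : v = i
      · subst hvi
        refine ⟨by omega, fun u hu hu' => ?_, fun hle => ?_⟩
        · by_cases hu1 : u = v + 1
          · rw [hu1, h2]
          · rw [← h4 u (by omega) hu1]
            exact c2 u (by omega) hu'
        · rw [← h4 _ (by omega) (by omega)]
          exact c3 hle
      · rw [← h4 v hvi hvi'] at hv ⊢
        obtain ⟨d1, d2, d3⟩ := hc v hv
        refine ⟨d1, fun u hu hu' => ?_, fun hle => ?_⟩
        · have hu0 := d2 u hu hu'
          have hui : u ≠ i := by rintro rfl; omega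
          by_cases hui' : u = i + 1
          · rw [hui', h2]
          · rwa [← h4 u hui hui']
        · have hpos := d3 hle
          have hui' : v + letterCount w' v ≠ i + 1 := by
            intro hui'
            have := d2 i (by omega) (by omega)
            omega
          generalize v + letterCount w' v = u at hpos hui'
          by_cases hui : u = i
          · rw [hui]; omega
          · rwa [← h4 u hui hui']

theorem descentToggle_left (h : IsSplit i w w') (hmin : ∀ j < i, ¬ HasDescent w j) :
    descentToggle w = w' := by
  have hex : ∃ i, HasDescent w i := ⟨i, h.hasDescent_left⟩
  have hfind : Nat.find hex = i := (Nat.find_eq_iff hex).2 ⟨h.hasDescent_left, hmin⟩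
  rw [descentToggle, dif_pos hex, hfind, h.toggle_left]

theorem descentToggle_right (h : IsSplit i w w') (hmin : ∀ j < i, ¬ HasDescent w j) :
    descentToggle w' = w := by
  have hex : ∃ i, HasDescent w' i := ⟨i, h.hasDescent_right⟩
  have hfind : Nat.find hex = i := (Nat.find_eq_iff hex).2
    ⟨h.hasDescent_right, fun j hj => fun hd => hmin j hj ((h.hasDescent_iff hj).2 hd)⟩
  rw [descentToggle, dif_pos hex, hfind, h.toggle_right]

theorem ne (h : IsSplit i w w') : w ≠ w' := by
  rintro rfl
  exact h.not_repeated h.repeated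

end IsSplit

theorem not_hasDescent_id (i : ℕ) : ¬ HasDescent (fun p : Fin m => (p : ℕ) + 1) i := by
  rintro (⟨q, p, h, hq, hp⟩ | ⟨p, hp, ⟨q, hq⟩, h⟩)
  · have : (q : ℕ) < p := h
    simp only at hq hp
    omega
  · have : (q : ℕ) < p := h q hq
    simp only at hq hp
    omega

theorem eq_id_of_forall_not_hasDescent {w : Fin m → ℕ} (hw : ∀ p, 1 ≤ w p ∧ w p ≤ m)
    (h : ∀ i, ¬ HasDescent w i) : w = fun p : Fin m => (p : ℕ) + 1 := by
  have hinj : Function.Injective w := by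
    intro a b hab
    by_contra hne
    rcases lt_or_gt_of_ne hne with h' | h'
    exacts [h _ (Or.inl ⟨a, b, h', hab, rfl⟩), h _ (Or.inl ⟨b, a, h', hab.symm, rfl⟩)]
  let e : Fin m → Fin m := fun p => ⟨w p - 1, by have := hw p; omega⟩
  have he : ∀ p, w p = e p + 1 := fun p => by
    have := hw p
    simp only [e]
    omega
  have hebij : Function.Bijective e := Finite.injective_iff_bijective.1 fun a b hab =>
    hinj (by rw [he, he, hab])
  choose g hg using hebij.2
  have hstep : ∀ (k : ℕ) (hk : k + 1 < m), g ⟨k, by omega⟩ < g ⟨k + 1, hk⟩ := by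
    intro k hk
    by_contra hlt
    have h1 : w (g ⟨k, by omega⟩) = k + 1 := by rw [he, hg]
    have h2 : w (g ⟨k + 1, hk⟩) = k + 1 + 1 := by rw [he, hg]
    refine h (k + 1) (Or.inr ⟨_, h1, ⟨_, h2⟩, fun q hq => ?_⟩)
    obtain rfl : q = g ⟨k + 1, hk⟩ := hinj (hq.trans h2.symm)
    refine lt_of_le_of_ne (not_lt.1 hlt) fun heq => ?_
    rw [heq] at h2
    omega
  have hmono : StrictMono g := by
    cases m with
    | zero => exact fun a => a.elim0
    | succ n => exact Fin.strictMono_iff_lt_succ.2 fun i => hstep i (by omega)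
  have hid : g = id := by
    refine (StrictMono.range_inj hmono strictMono_id).1 ?_
    rw [Set.range_id, Set.range_eq_univ]
    exact Finite.surjective_of_injective hmono.injective
  ext p
  have := hg p
  rw [hid, id] at this
  rw [he, this]

/-- An allowable word other than `1 2 ⋯ m` is one half of a split pair exchanged by
`descentToggle`. -/
theorem exists_isSplit (hm : 1 ≤ m) {w : Fin m → ℕ} (hw : IsAllowableWord m w)
    (hd : ∃ i, HasDescent w i) :
    ∃ i, i + 1 ≤ m ∧ descentToggle (descentToggle w) = w ∧
      (IsSplit i w (descentToggle w) ∨ IsSplit i (descentToggle w) w) := by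
  obtain ⟨hr, -, hc⟩ := (isAllowableWord_iff hm w).1 hw
  have hspec := Nat.find_spec hd
  have hmin : ∀ j < Nat.find hd, ¬ HasDescent w j := fun j hj => Nat.find_min hd hj
  generalize Nat.find hd = i at hspec hmin
  refine ⟨i, ?_⟩
  by_cases hrep : ∃ q p, q < p ∧ w q = i ∧ w p = i
  · have hcount := one_lt_letterCount.2 hrep
    obtain ⟨c1, c2, -⟩ := hc i (by omega)
    have hs := isSplit_splitLetter hrep fun q hq => by
      have := letterCount_pos.2 ⟨q, hq⟩
      have := c2 (i + 1) (by omega) (by omega)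
      omega
    rw [hs.descentToggle_left hmin, hs.descentToggle_right hmin]
    exact ⟨by omega, rfl, Or.inl hs⟩
  · have hs := isSplit_mergeLetter hrep hspec
    obtain ⟨-, -, ⟨q, hq⟩, -⟩ := hspec.resolve_left hrep
    have hmin' : ∀ j < i, ¬ HasDescent (mergeLetter i w) j :=
      fun j hj hd' => hmin j hj ((hs.hasDescent_iff hj).1 hd')
    have := hr q
    rw [hs.descentToggle_right hmin', hs.descentToggle_left hmin']
    exact ⟨by omega, rfl, Or.inr hs⟩

theorem descentToggle_of_forall_not {w : Fin m → ℕ} (h : ¬ ∃ i, HasDescent w i) :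
    descentToggle w = w := dif_neg h

end AllowableWord

/-- there is a sign-reversing involution `φ` on the set of words of
length `m` over `{1, …, m}` with allowable content, whose unique fixed point is the
word `1 2 ⋯ m`, which changes the number of zeros of the content by exactly `1` on
non-fixed words, and which preserves the number of tied inversions. -/
theorem stmt2 (m : ℕ) (hm : 1 ≤ m) :
    ∃ φ : (Fin m → ℕ) → (Fin m → ℕ),
      (∀ w, IsAllowableWord m w → IsAllowableWord m (φ w)) ∧
      (∀ w, IsAllowableWord m w → φ (φ w) = w) ∧
      (φ (fun p : Fin m => (p : ℕ) + 1) = fun p : Fin m => (p : ℕ) + 1) ∧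
      (∀ w, IsAllowableWord m w → (φ w = w ↔ w = fun p : Fin m => (p : ℕ) + 1)) ∧
      (∀ w, IsAllowableWord m w → φ w ≠ w →
        zerosW m (φ w) = zerosW m w + 1 ∨ zerosW m w = zerosW m (φ w) + 1) ∧
      ∀ w, IsAllowableWord m w → tiedInvW m (φ w) = tiedInvW m w := by

  open AllowableWord in
  have hid : descentToggle (fun p : Fin m => (p : ℕ) + 1) = fun p : Fin m => (p : ℕ) + 1 :=
    descentToggle_of_forall_not fun ⟨i, hi⟩ => not_hasDescent_id i hi
  refine ⟨AllowableWord.descentToggle, fun w hw => ?_, fun w hw => ?_, hid,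
    fun w hw => ⟨fun h => ?_, fun h => h ▸ hid⟩, fun w hw hne => ?_, fun w hw => ?_⟩ <;>
  by_cases hd : ∃ i, AllowableWord.HasDescent w i
  · obtain ⟨i, -, -, h | h⟩ := AllowableWord.exists_isSplit hm hw hd
    exacts [(h.isAllowableWord_iff hm).1 hw, (h.isAllowableWord_iff hm).2 hw]
  · rwa [AllowableWord.descentToggle_of_forall_not hd]
  · obtain ⟨i, -, h, -⟩ := AllowableWord.exists_isSplit hm hw hd
    exact h
  · simp only [AllowableWord.descentToggle_of_forall_not hd]
  · obtain ⟨i, -, -, h' | h'⟩ := AllowableWord.exists_isSplit hm hw hd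
    exacts [absurd h.symm h'.ne, absurd h h'.ne]
  · exact AllowableWord.eq_id_of_forall_not_hasDescent hw.1 (not_exists.1 hd)
  · obtain ⟨i, him, -, h | h⟩ := AllowableWord.exists_isSplit hm hw hd
    exacts [Or.inr (h.zerosW_eq him), Or.inl (h.zerosW_eq him)]
  · exact absurd (AllowableWord.descentToggle_of_forall_not hd) hne
  · obtain ⟨i, -, -, h | h⟩ := AllowableWord.exists_isSplit hm hw hd
    exacts [h.tiedInvW_eq.symm, h.tiedInvW_eq]
  · rw [AllowableWord.descentToggle_of_forall_not hd]
end

section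
/- Fix N ≥ 1. For placed columns (S_1, t_1) (on the left) and (S_2, t_2) (on the right) with |S_1| = b_1 and |S_2| = b_2, the quantity Inv((S_1,t_1),(S_2,t_2)) + Invbar of their complements depends only on b_1, b_2, t_1 and t_2, and not on the particular subsets S_1, S_2 ⊆ {1,…,N}. That is, if S_1' and S_2' are any other subsets of {1,…,N} with |S_1'| = b_1 and |S_2'| = b_2, then Inv((S_1,t_1),(S_2,t_2)) + Invbar((S̄_1,·),(S̄_2,·)) = Inv((S_1',t_1),(S_2',t_2)) + Invbar((S̄_1',·),(S̄_2',·)). -/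
open scoped Classical

noncomputable section

/-- A placed column `(S, t)` occupies the rows `t, t-1, …, t-|S|+1`;
`colOcc S t r` says that row `r` is occupied. -/
def colOcc (S : Finset ℕ) (t r : ℤ) : Prop :=
  t - S.card + 1 ≤ r ∧ r ≤ t

/-- The value of the placed column `(S, t)` in row `r`: the elements of `S` are
listed in increasing order from bottom to top. -/
def colVal (S : Finset ℕ) (t r : ℤ) : ℕ :=
  (S.sort (· ≤ ·)).getD (r - (t - S.card + 1)).toNat 0

/-- The complement of the placed column `(S, t)` (inside `{1, …, N}`) occupies the
rows `t - |S|, …, t - N + 1`. -/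
def compOcc (N : ℕ) (S : Finset ℕ) (t r : ℤ) : Prop :=
  t - N + 1 ≤ r ∧ r ≤ t - S.card

/-- The value of the complement of `(S, t)` in row `r`: the elements of
`{1, …, N} \ S` are listed in increasing order from top to bottom. -/
def compVal (N : ℕ) (S : Finset ℕ) (t r : ℤ) : ℕ :=
  ((Finset.Icc 1 N \ S).sort (· ≤ ·)).getD ((t - S.card) - r).toNat 0

/-- `Inv`: the number of attacking pairs `(x, y)` of column entries with
`value x < value y`, where `(S₁, t₁)` is the left column and `(S₂, t₂)` the right
one.  An attacking pair has `x` in the left column and `y` in the right column in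
the same row, or `x` in the right column and `y` in the left column in the row
directly above `x`. -/
def InvLR (N : ℕ) (S₁ : Finset ℕ) (t₁ : ℤ) (S₂ : Finset ℕ) (t₂ : ℤ) : ℕ :=
  ((Finset.Icc (min t₁ t₂ - N) (max t₁ t₂)).filter fun r =>
      colOcc S₁ t₁ r ∧ colOcc S₂ t₂ r ∧ colVal S₁ t₁ r < colVal S₂ t₂ r).card +
  ((Finset.Icc (min t₁ t₂ - N) (max t₁ t₂)).filter fun r =>
      colOcc S₂ t₂ r ∧ colOcc S₁ t₁ (r + 1) ∧ colVal S₂ t₂ r < colVal S₁ t₁ (r + 1)).card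

/-- `Invbar`: the number of attacking pairs `(x, y)` of complement entries with
`value x ≤ value y`. -/
def InvbarLR (N : ℕ) (S₁ : Finset ℕ) (t₁ : ℤ) (S₂ : Finset ℕ) (t₂ : ℤ) : ℕ :=
  ((Finset.Icc (min t₁ t₂ - N) (max t₁ t₂)).filter fun r =>
      compOcc N S₁ t₁ r ∧ compOcc N S₂ t₂ r ∧ compVal N S₁ t₁ r ≤ compVal N S₂ t₂ r).card +
  ((Finset.Icc (min t₁ t₂ - N) (max t₁ t₂)).filter fun r =>
      compOcc N S₂ t₂ r ∧ compOcc N S₁ t₁ (r + 1) ∧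
        compVal N S₂ t₂ r ≤ compVal N S₁ t₁ (r + 1)).card

/-- `S.below n` is the number of elements of `S` smaller than `n`. -/
abbrev Finset.below (S : Finset ℕ) (n : ℕ) : ℕ := Nat.count (· ∈ S) n

namespace Finset

variable {S : Finset ℕ}

theorem sort_getD_eq_nth (S : Finset ℕ) (k : ℕ) :
    (S.sort (· ≤ ·)).getD k 0 = Nat.nth (· ∈ S) k := by
  have hf : (Set.ofPred (· ∈ S)).Finite := S.finite_toSet
  rw [Nat.nth_eq_getD_sort hf]
  congr 2
  ext x
  simp

theorem lt_card_toFinset_of_lt_card {k : ℕ} (hk : k < S.card)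
    (hf : (Set.ofPred (· ∈ S)).Finite) : k < hf.toFinset.card := by
  have h : hf.toFinset = S := by ext x; simp
  rwa [h]

theorem below_le_card (S : Finset ℕ) (n : ℕ) : S.below n ≤ S.card := by
  rw [below, Nat.count_eq_card_filter_range]
  exact card_le_card fun x hx => (mem_filter.1 hx).2

theorem below_succ (S : Finset ℕ) (n : ℕ) :
    S.below (n + 1) = S.below n + if n ∈ S then 1 else 0 := by
  rw [below, Nat.count_succ]

theorem below_lt_card {u : ℕ} (hu : u ∈ S) : S.below u < S.card := by
  have h := S.below_le_card (u + 1)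
  rw [below_succ, if_pos hu] at h
  exact h

theorem le_nth_iff_below_le {n k : ℕ} (hk : k < S.card) :
    n ≤ Nat.nth (· ∈ S) k ↔ S.below n ≤ k := by
  refine ⟨Nat.le_nth_of_count_le, fun h => ?_⟩
  by_contra! hlt
  have h₁ : S.below (Nat.nth (· ∈ S) k + 1) ≤ S.below n := Nat.count_monotone _ hlt
  have h₂ := Nat.count_nth_succ (lt_card_toFinset_of_lt_card hk)
  simp only [below] at *
  omega

theorem below_one {N : ℕ} (hS : S ⊆ Icc 1 N) : S.below 1 = 0 := by
  have h : 0 ∉ S := fun h => by simpa using hS h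
  simp [below, Nat.count_succ, h]

theorem below_eq_card {N : ℕ} (hS : S ⊆ Icc 1 N) : S.below (N + 1) = S.card := by
  rw [below, Nat.count_eq_card_filter_range]
  congr 1
  ext x
  have := @hS x
  simp only [mem_filter, mem_range, mem_Icc] at *
  grind

theorem below_compl_add_below {N u : ℕ} (hS : S ⊆ Icc 1 N) (hu : u ≤ N) :
    (Icc 1 N \ S).below (u + 1) + S.below (u + 1) = u := by
  induction u with
  | zero => rw [below_one sdiff_subset, below_one hS]
  | succ n ih =>
    have := ih (by omega)
    rw [below_succ, below_succ S]
    by_cases h : n + 1 ∈ S <;> simp [h, hu] <;> omega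

/-- Rows numbered by `f` (with inverse `g`) correspond to the elements of `P` through the increasing
enumeration of `P`. -/
theorem card_filter_nth {P : Finset ℕ} {R : Finset ℤ} {f : ℤ → ℕ} {g : ℕ → ℤ}
    {p : ℤ → Prop} {q : ℕ → Prop} [DecidablePred p] [DecidablePred q]
    (hf : ∀ r ∈ R, f r < P.card) (hg : ∀ k < P.card, g k ∈ R)
    (hgf : ∀ r ∈ R, g (f r) = r) (hfg : ∀ k < P.card, f (g k) = k)
    (hpq : ∀ r ∈ R, (p r ↔ q (Nat.nth (· ∈ P) (f r)))) :
    (R.filter p).card = (P.filter q).card := by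
  have key : ∀ u ∈ P, Nat.nth (· ∈ P) (f (g (P.below u))) = u := fun u hu => by
    rw [hfg _ (below_lt_card hu)]
    exact Nat.nth_count (p := (· ∈ P)) hu
  refine card_nbij' (fun r => Nat.nth (· ∈ P) (f r)) (fun u => g (P.below u)) ?_ ?_ ?_ ?_
  · intro r hr
    simp only [coe_filter, Set.mem_ofPred_eq] at hr ⊢
    exact ⟨Nat.nth_mem _ (lt_card_toFinset_of_lt_card (hf r hr.1)), (hpq r hr.1).1 hr.2⟩
  · intro u hu
    simp only [coe_filter, Set.mem_ofPred_eq] at hu ⊢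
    have hR := hg _ (below_lt_card hu.1)
    exact ⟨hR, (hpq _ hR).2 (by rw [key u hu.1]; exact hu.2)⟩
  · intro r hr
    simp only [coe_filter, Set.mem_ofPred_eq] at hr
    have h := Nat.count_nth (lt_card_toFinset_of_lt_card (hf r hr.1))
    simp only [below, h, hgf r hr.1]
  · intro u hu
    simp only [coe_filter, Set.mem_ofPred_eq] at hu
    exact key u hu.1

end Finset

theorem colVal_eq_nth (S : Finset ℕ) (t r : ℤ) :
    colVal S t r = Nat.nth (· ∈ S) (r - (t - S.card + 1)).toNat :=
  S.sort_getD_eq_nth _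

theorem compVal_eq_nth (N : ℕ) (S : Finset ℕ) (t r : ℤ) :
    compVal N S t r = Nat.nth (· ∈ Finset.Icc 1 N \ S) (t - S.card - r).toNat :=
  Finset.sort_getD_eq_nth _ _

theorem colOcc_add_one (S : Finset ℕ) (t r : ℤ) : colOcc S t (r + 1) ↔ colOcc S (t - 1) r := by
  unfold colOcc
  omega

theorem compOcc_add_one (N : ℕ) (S : Finset ℕ) (t r : ℤ) :
    compOcc N S t (r + 1) ↔ compOcc N S (t - 1) r := by
  unfold compOcc
  omega

theorem colVal_add_one (S : Finset ℕ) (t r : ℤ) : colVal S t (r + 1) = colVal S (t - 1) r := by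
  rw [colVal_eq_nth, colVal_eq_nth]
  congr 2
  ring

theorem compVal_add_one (N : ℕ) (S : Finset ℕ) (t r : ℤ) :
    compVal N S t (r + 1) = compVal N S (t - 1) r := by
  rw [compVal_eq_nth, compVal_eq_nth]
  congr 2
  ring

/-- Same-row inversions of two columns, together with the rows of the first column above the
second one, counted by elements of the first column. -/
theorem card_col_inversions (P Q : Finset ℕ) {t s lo hi : ℤ}
    (hlo : lo ≤ t - P.card + 1) (hhi : t ≤ hi) :
    ((Finset.Icc lo hi).filter fun r =>
      colOcc P t r ∧ colOcc Q s r ∧ colVal P t r < colVal Q s r).card +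
      ((Finset.Icc (t - P.card + 1) t).filter fun r => s < r).card =
    (P.filter fun u => Q.below (u + 1) + s - Q.card ≤ t - P.card + P.below u).card := by
  rw [← Finset.card_union_of_disjoint, ← Finset.card_filter_nth (P := P)
    (R := Finset.Icc (t - P.card + 1) t) (f := fun r => (r - (t - P.card + 1)).toNat)
    (g := fun k => t - P.card + 1 + k)
    (p := fun r => (colOcc P t r ∧ colOcc Q s r ∧ colVal P t r < colVal Q s r) ∨ s < r)]
  · congr 1
    ext r
    simp only [Finset.mem_union, Finset.mem_filter, Finset.mem_Icc, colOcc]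
    grind
  · intro r hr
    rw [Finset.mem_Icc] at hr
    omega
  · intro k hk
    rw [Finset.mem_Icc]
    omega
  · intro r hr
    rw [Finset.mem_Icc] at hr
    omega
  · intro k hk
    omega
  · intro r hr
    rw [Finset.mem_Icc] at hr
    have hk : (r - (t - P.card + 1)).toNat < P.card := by omega
    have hb := Nat.count_nth (Finset.lt_card_toFinset_of_lt_card hk)
    simp only [colVal_eq_nth, colOcc, Finset.below, hb]
    generalize Nat.nth (· ∈ P) (r - (t - P.card + 1)).toNat = u
    have hQ := Q.below_le_card (u + 1)
    by_cases hk' : (r - (s - Q.card + 1)).toNat < Q.card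
    · rw [← Nat.succ_le_iff, Nat.succ_eq_add_one, Finset.le_nth_iff_below_le hk']
      simp only [Finset.below] at *
      omega
    · simp only [Finset.below] at *
      omega
  · rw [Finset.disjoint_left]
    intro r h₁ h₂
    exact (Finset.mem_filter.1 h₁).2.2.1.2.not_gt (Finset.mem_filter.1 h₂).2

/-- Same-row weak inversions of two complements, together with the rows of the first complement
below the second one, counted by elements of the first complement. -/
theorem card_comp_inversions {N : ℕ} {P Q : Finset ℕ} (hP : P ⊆ Finset.Icc 1 N)
    (hQ : Q ⊆ Finset.Icc 1 N) {t s lo hi : ℤ} (hlo : lo ≤ t - N + 1) (hhi : t ≤ hi) :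
    ((Finset.Icc lo hi).filter fun r =>
      compOcc N P t r ∧ compOcc N Q s r ∧ compVal N P t r ≤ compVal N Q s r).card +
      ((Finset.Icc (t - N + 1) (t - P.card)).filter fun r => r ≤ s - N).card =
    ((Finset.Icc 1 N \ P).filter fun u =>
      t - P.card + P.below u ≤ s - Q.card + Q.below u).card := by
  have hPN : (Finset.Icc 1 N \ P).card + P.card = N := by
    simpa using Finset.card_sdiff_add_card_eq_card hP
  have hQN : (Finset.Icc 1 N \ Q).card + Q.card = N := by
    simpa using Finset.card_sdiff_add_card_eq_card hQ
  rw [← Finset.card_union_of_disjoint, ← Finset.card_filter_nth (P := Finset.Icc 1 N \ P)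
    (R := Finset.Icc (t - N + 1) (t - P.card)) (f := fun r => (t - P.card - r).toNat)
    (g := fun k => t - P.card - k)
    (p := fun r => (compOcc N P t r ∧ compOcc N Q s r ∧ compVal N P t r ≤ compVal N Q s r) ∨
      r ≤ s - N)]
  · congr 1
    ext r
    simp only [Finset.mem_union, Finset.mem_filter, Finset.mem_Icc, compOcc]
    grind
  · intro r hr
    rw [Finset.mem_Icc] at hr
    omega
  · intro k hk
    rw [Finset.mem_Icc]
    omega
  · intro r hr
    rw [Finset.mem_Icc] at hr
    omega
  · intro k hk
    omega
  · intro r hr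
    rw [Finset.mem_Icc] at hr
    have hk : (t - P.card - r).toNat < (Finset.Icc 1 N \ P).card := by omega
    have hb := Nat.count_nth (Finset.lt_card_toFinset_of_lt_card hk)
    have hu := Nat.nth_mem _ (Finset.lt_card_toFinset_of_lt_card hk)
    simp only [compVal_eq_nth, compOcc]
    generalize Nat.nth (· ∈ Finset.Icc 1 N \ P) (t - P.card - r).toNat = u at *
    have huN : 1 ≤ u ∧ u ≤ N := by simpa using (Finset.mem_sdiff.1 hu).1
    obtain ⟨v, rfl⟩ : ∃ v, u = v + 1 := ⟨u - 1, by omega⟩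
    have hP' := Finset.below_compl_add_below hP (u := v) (by omega)
    have hQ' := Finset.below_compl_add_below hQ (u := v) (by omega)
    have hQc := (Finset.Icc 1 N \ Q).below_le_card (v + 1)
    by_cases hk' : (s - Q.card - r).toNat < (Finset.Icc 1 N \ Q).card
    · rw [Finset.le_nth_iff_below_le hk']
      simp only [Finset.below] at *
      omega
    · simp only [Finset.below] at *
      omega
  · rw [Finset.disjoint_left]
    intro r h₁ h₂
    have h₃ := (Finset.mem_filter.1 h₁).2.2.1.1
    have h₄ := (Finset.mem_filter.1 h₂).2
    omega

/-- The total of the four element counts for a pair of columns is independent of the columns. -/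
theorem sum_card_filter_below {N : ℕ} {P Q : Finset ℕ} (hP : P ⊆ Finset.Icc 1 N)
    (hQ : Q ⊆ Finset.Icc 1 N) (x y : ℤ) :
    ((P.filter fun u => Q.below (u + 1) + y - Q.card ≤ x - P.card + P.below u).card +
      (Q.filter fun u => P.below (u + 1) + (x - 1) - P.card ≤ y - Q.card + Q.below u).card +
      ((Finset.Icc 1 N \ P).filter fun u =>
        x - P.card + P.below u ≤ y - Q.card + Q.below u).card +
      ((Finset.Icc 1 N \ Q).filter fun u =>
        y - Q.card + Q.below u ≤ x - 1 - P.card + P.below u).card : ℤ) =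
    N + max (x - y - 1) (y - x) -
      max (x - P.card - (y - Q.card) - 1) (y - Q.card - (x - P.card)) := by
  have hfilter : ∀ {S : Finset ℕ} (q : ℕ → Prop) [DecidablePred q], S ⊆ Finset.Icc 1 N →
      ((S.filter q).card : ℤ) = ∑ u ∈ Finset.Icc 1 N, if u ∈ S ∧ q u then 1 else 0 := by
    intro S q _ hS
    rw [Finset.sum_boole]
    congr 2
    ext u
    have := @hS u
    simp only [Finset.mem_filter]
    tauto
  set F : ℕ → ℤ := fun u =>
    max (x - P.card + P.below u - (y - Q.card + Q.below u) - 1)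
      (y - Q.card + Q.below u - (x - P.card + P.below u)) with hF
  have htel : ∀ n, ∑ u ∈ Finset.Icc 1 n, (1 + F (u + 1) - F u) = n + F (n + 1) - F 1 := by
    intro n
    induction n with
    | zero => simp
    | succ n ih =>
      rw [Finset.sum_Icc_succ_top (by omega), ih]
      push_cast
      ring
  have hN := htel N
  have h₁ : F 1 = max (x - P.card - (y - Q.card) - 1) (y - Q.card - (x - P.card)) := by
    simp only [hF, Finset.below_one hP, Finset.below_one hQ]
    simp
  have h₂ : F (N + 1) = max (x - y - 1) (y - x) := by
    simp only [hF, Finset.below_eq_card hP, Finset.below_eq_card hQ]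
    congr 1 <;> ring
  rw [h₁, h₂] at hN
  rw [← hN, hfilter _ hP, hfilter _ hQ, hfilter _ Finset.sdiff_subset,
    hfilter _ Finset.sdiff_subset, ← Finset.sum_add_distrib, ← Finset.sum_add_distrib,
    ← Finset.sum_add_distrib]
  refine Finset.sum_congr rfl fun u hu => ?_
  simp only [hF, Finset.below_succ, Finset.mem_sdiff, hu, true_and]
  generalize P.below u = a
  generalize Q.below u = b
  by_cases hp : u ∈ P <;> by_cases hq : u ∈ Q <;>
    simp only [hp, hq, if_true, if_false, true_and, false_and, not_true, not_false_eq_true] <;>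
    push_cast <;> split_ifs <;> omega

/-- Closed form of `Inv + Invbar`, up to counts of rows that depend only on the shapes. -/
theorem InvLR_add_InvbarLR {N : ℕ} {P Q : Finset ℕ} (hP : P ⊆ Finset.Icc 1 N)
    (hQ : Q ⊆ Finset.Icc 1 N) (x y : ℤ) :
    ((InvLR N P x Q y + InvbarLR N P x Q y : ℕ) : ℤ) =
      N + max (x - y - 1) (y - x) -
        max (x - P.card - (y - Q.card) - 1) (y - Q.card - (x - P.card)) -
      ((Finset.Icc (x - P.card + 1) x).filter fun r => y < r).card -
      ((Finset.Icc (y - Q.card + 1) y).filter fun r => x - 1 < r).card -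
      ((Finset.Icc (x - N + 1) (x - P.card)).filter fun r => r ≤ y - N).card -
      ((Finset.Icc (y - N + 1) (y - Q.card)).filter fun r => r ≤ x - 1 - N).card := by
  have hPN : P.card ≤ N := by simpa using Finset.card_le_card hP
  have hQN : Q.card ≤ N := by simpa using Finset.card_le_card hQ
  have h := sum_card_filter_below hP hQ x y
  rw [← card_col_inversions P Q (t := x) (s := y) (lo := min x y - N) (hi := max x y)
      (by omega) (by omega),
    ← card_col_inversions Q P (t := y) (s := x - 1) (lo := min x y - N) (hi := max x y)
      (by omega) (by omega),
    ← card_comp_inversions hP hQ (t := x) (s := y) (lo := min x y - N) (hi := max x y)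
      (by omega) (by omega),
    ← card_comp_inversions hQ hP (t := y) (s := x - 1) (lo := min x y - N) (hi := max x y)
      (by omega) (by omega)] at h
  simp only [InvLR, InvbarLR, colOcc_add_one, colVal_add_one, compOcc_add_one, compVal_add_one]
  push_cast at h ⊢
  linarith

/-- `Inv + Invbar` for a pair of placed columns depends only on the
sizes `|S₁|, |S₂|` and the top rows `t₁, t₂`, not on the particular subsets. -/
theorem stmt3 (N : ℕ) (hN : 1 ≤ N) (S₁ S₂ S₁' S₂' : Finset ℕ)
    (hS₁ : S₁ ⊆ Finset.Icc 1 N) (hS₂ : S₂ ⊆ Finset.Icc 1 N)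
    (hS₁' : S₁' ⊆ Finset.Icc 1 N) (hS₂' : S₂' ⊆ Finset.Icc 1 N)
    (hc₁ : S₁'.card = S₁.card) (hc₂ : S₂'.card = S₂.card) (t₁ t₂ : ℤ) :
    InvLR N S₁ t₁ S₂ t₂ + InvbarLR N S₁ t₁ S₂ t₂ =
      InvLR N S₁' t₁ S₂' t₂ + InvbarLR N S₁' t₁ S₂' t₂ := by
  zify
  have h := InvLR_add_InvbarLR hS₁ hS₂ t₁ t₂
  have h' := InvLR_add_InvbarLR hS₁' hS₂' t₁ t₂
  rw [hc₁, hc₂] at h'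
  exact_mod_cast h.trans h'.symm

end
end

section
/- Fix integers n > k ≥ 1. Let P_0 be the complete shrunken diagram with parameters (n,k) all of whose k columns are basic, i.e., each column occupies rows 1 through n−k+1 with labels 0,1,…,n−k from bottom to top. Then Inv(P_0) + pathdinv(P_0) = maxInv(P_0). -/
open scoped Classical

noncomputable section

/-- Raw data of a diagram with `k` columns: each column `i` has labeled boxes in the
rows `h i, h i + 1, …, h' i` (rows indexed by integers, increasing upward), and
`lab i r` is the label of the box of column `i` in row `r`. -/
structure SDiag (k : ℕ) where
  h : Fin k → ℤ
  h' : Fin k → ℤ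
  lab : Fin k → ℤ → ℕ

/-- A *complete shrunken diagram* with parameters `(n, k)` (with `N = n - k`):
labels lie in `{0, 1, …, N}` and weakly increase up each column, only the label `0`
may repeat within a column, `h' i ≥ N + 1`, `h 0 = 1`, `h' (k-1) = N + 1`, and
`h (i+1) = h' i - N`. -/
def IsCompleteSD (n k : ℕ) (P : SDiag k) : Prop :=
  (∀ i, P.h i ≤ P.h' i) ∧
  (∀ i, ((n : ℤ) - k) + 1 ≤ P.h' i) ∧
  (∀ h0 : 0 < k, P.h ⟨0, h0⟩ = 1) ∧
  (∀ h0 : 0 < k, P.h' ⟨k - 1, Nat.sub_lt h0 Nat.one_pos⟩ = ((n : ℤ) - k) + 1) ∧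
  (∀ (i : Fin k) (hi : (i : ℕ) + 1 < k), P.h ⟨(i : ℕ) + 1, hi⟩ = P.h' i - ((n : ℤ) - k)) ∧
  (∀ i r, P.h i ≤ r → r ≤ P.h' i → P.lab i r ≤ n - k) ∧
  ∀ i r r', P.h i ≤ r → r < r' → r' ≤ P.h' i →
    P.lab i r < P.lab i r' ∨ (P.lab i r = 0 ∧ P.lab i r' = 0)

/-- Row `r` of column `i` holds a labeled box. -/
def occS {k : ℕ} (P : SDiag k) (i : Fin k) (r : ℤ) : Prop := P.h i ≤ r ∧ r ≤ P.h' i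

/-- `maxInvS P`: the number of attacking pairs `(x, y)` of labeled boxes, i.e. `x` in
the same row as `y` and strictly to its left, or `x` in the row directly below `y`
and strictly to its right. -/
def maxInvS {k : ℕ} (P : SDiag k) : ℕ :=
  ∑ i : Fin k, ∑ j : Fin k,
    ((Finset.Icc (P.h i) (P.h' i)).filter fun r =>
      (i < j ∧ occS P j r) ∨ (j < i ∧ occS P j (r + 1))).card

/-- `InvS P`: the number of attacking pairs `(x, y)` of labeled boxes with
`label x < label y`. -/
def InvS {k : ℕ} (P : SDiag k) : ℕ :=
  ∑ i : Fin k, ∑ j : Fin k,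
    ((Finset.Icc (P.h i) (P.h' i)).filter fun r =>
      (i < j ∧ occS P j r ∧ P.lab i r < P.lab j r) ∨
      (j < i ∧ occS P j (r + 1) ∧ P.lab i r < P.lab j (r + 1))).card

/-- `pathdinvS n k P`: the number of ordered pairs of boxes `(x, y)` in the same
row with `x` strictly to the left of `y`, `y` a labeled box, and `x` (labeled or
not) at most `n - k + 1` rows below the topmost labeled box of its column. -/
def pathdinvS (n k : ℕ) (P : SDiag k) : ℕ :=
  ∑ i : Fin k, ∑ j : Fin k,
    if i < j then
      ((Finset.Icc (P.h j) (P.h' j)).filter fun r =>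
        P.h' i - ((n : ℤ) - k + 1) ≤ r).card
    else 0

/-- The number of nonzero labels of column `i`. -/
def bS {k : ℕ} (P : SDiag k) (i : Fin k) : ℕ :=
  ((Finset.Icc (P.h i) (P.h' i)).filter fun r => P.lab i r ≠ 0).card

/-- The complement of column `i`: the elements of `{1, …, n-k}` not occurring as
labels of column `i`. -/
def compSetS (n k : ℕ) (P : SDiag k) (i : Fin k) : Finset ℕ :=
  (Finset.Icc 1 (n - k)).filter fun v => ∀ r, P.h i ≤ r → r ≤ P.h' i → P.lab i r ≠ v

/-- The row of the complement entry `v` of column `i`: the complement entries are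
written in increasing order from top to bottom in the rows
`h' i - bS i, h' i - bS i - 1, …`. -/
def compRowS (n k : ℕ) (P : SDiag k) (i : Fin k) (v : ℕ) : ℤ :=
  P.h' i - bS P i - ((compSetS n k P i).filter fun u => u < v).card

/-- A *generalized shrunken fixed point*: a complete shrunken diagram whose
complement reading word (row by row from top to bottom, right to left within each
row) is strictly increasing. -/
def IsGSFP (n k : ℕ) (P : SDiag k) : Prop :=
  IsCompleteSD n k P ∧
  ∀ (i i' : Fin k) (v v' : ℕ), v ∈ compSetS n k P i → v' ∈ compSetS n k P i' →
    (compRowS n k P i' v' < compRowS n k P i v ∨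
      (compRowS n k P i v = compRowS n k P i' v' ∧ i' < i)) →
    v < v'

/-- Column `i` is *basic*: it occupies rows `1` through `n - k + 1` with labels
`0, 1, …, n - k` from bottom to top. -/
def IsBasicCol (n k : ℕ) (P : SDiag k) (i : Fin k) : Prop :=
  P.h i = 1 ∧ P.h' i = (n : ℤ) - k + 1 ∧
  ∀ r : ℤ, 1 ≤ r → r ≤ (n : ℤ) - k + 1 → P.lab i r = (r - 1).toNat

/-- for the complete shrunken diagram all of whose columns are basic,
`Inv + pathdinv = maxInv`. -/
theorem stmt5 (n k : ℕ) (hk : 1 ≤ k) (hnk : k < n) (P : SDiag k)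
    (hP : IsCompleteSD n k P) (hbasic : ∀ i, IsBasicCol n k P i) :
    InvS P + pathdinvS n k P = maxInvS P := by
  unfold InvS pathdinvS maxInvS
  simp only [← Finset.sum_add_distrib]
  refine Finset.sum_congr rfl fun i _ => Finset.sum_congr rfl fun j _ => ?_
  obtain ⟨hi, hi', hli⟩ := hbasic i
  obtain ⟨hj, hj', hlj⟩ := hbasic j
  have hocc : ∀ r, occS P j r ↔ 1 ≤ r ∧ r ≤ (n : ℤ) - k + 1 := fun r => by
    rw [occS, hj, hj']
  rw [hi, hi', hj, hj']
  by_cases hij : i < j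
  · have hji : ¬ j < i := not_lt_of_gt hij
    rw [if_pos hij, Finset.filter_false_of_mem, Finset.filter_true_of_mem,
      Finset.filter_true_of_mem, Finset.card_empty, zero_add]
    · intro r hr
      exact Or.inl ⟨hij, (hocc r).2 (Finset.mem_Icc.1 hr)⟩
    · intro r hr
      have := Finset.mem_Icc.1 hr
      omega
    · intro r hr
      obtain ⟨h1, h2⟩ := Finset.mem_Icc.1 hr
      rw [hli r h1 h2, hlj r h1 h2]
      rintro (⟨-, -, h⟩ | ⟨h, -⟩)
      exacts [lt_irrefl _ h, hji h]
  · rw [if_neg hij, add_zero]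
    refine congrArg Finset.card (Finset.filter_congr fun r hr => ?_)
    obtain ⟨h1, h2⟩ := Finset.mem_Icc.1 hr
    simp only [hij, false_and, false_or]
    refine and_congr_right fun _ => and_iff_left_of_imp fun h => ?_
    obtain ⟨h3, h4⟩ := (hocc _).1 h
    rw [hli r h1 h2, hlj (r + 1) h3 h4]
    omega

end
end

section
/- Fix integers n > k ≥ 1. Let P be a generalized shrunken fixed point with parameters (n,k), let C be its leftmost non-basic column, and suppose some element of {1,…,n−k} does not occur among the labels of C; let m be the smallest such element. Let P' be obtained from P by removing the highest label 0 in column C, moving each of the labels 1, 2, …, m−1 of C down one row, and placing the label m in the row that contained m−1 (or, if m = 1, in the row of the removed 0). Then P' is again a generalized shrunken fixed point, and Inv(P') = Inv(P), pathdinv(P') = pathdinv(P), and maxInv(P') = maxInv(P). -/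
open scoped Classical

noncomputable section

section Column

variable {n k : ℕ} {P : SDiag k} {i : Fin k} {r : ℤ}

lemma lab_eq_zero_iff (hP : IsCompleteSD n k P) (h₁ : P.h i ≤ r) (h₂ : r ≤ P.h' i) :
    P.lab i r = 0 ↔ r ≤ P.h' i - bS P i := by
  obtain ⟨-, -, -, -, -, -, hmono⟩ := hP
  constructor
  · intro h0
    have hsub : ((Finset.Icc (P.h i) (P.h' i)).filter fun s => P.lab i s ≠ 0) ⊆
        Finset.Ioc r (P.h' i) := by
      intro s hs
      simp only [Finset.mem_filter, Finset.mem_Icc, Finset.mem_Ioc] at hs ⊢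
      refine ⟨?_, hs.1.2⟩
      by_contra hsr
      rcases eq_or_lt_of_le (not_lt.1 hsr) with rfl | hlt
      · exact hs.2 h0
      · have := hmono i s r hs.1.1 hlt h₂
        omega
    have := Finset.card_le_card hsub
    rw [Int.card_Ioc] at this
    unfold bS
    omega
  · intro hr
    by_contra h0
    have hsub : Finset.Icc r (P.h' i) ⊆
        ((Finset.Icc (P.h i) (P.h' i)).filter fun s => P.lab i s ≠ 0) := by
      intro s hs
      simp only [Finset.mem_filter, Finset.mem_Icc] at hs ⊢
      refine ⟨⟨by omega, hs.2⟩, ?_⟩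
      rcases eq_or_lt_of_le hs.1 with rfl | hlt
      · exact h0
      · have := hmono i r s h₁ hlt hs.2
        omega
    have := Finset.card_le_card hsub
    rw [Int.card_Icc] at this
    unfold bS at hr
    omega

lemma card_compSetS_le_add_card (hP : IsCompleteSD n k P) {v : ℕ} (hv : v ≤ n - k) :
    ((compSetS n k P i).filter fun u => u ≤ v).card +
      ((Finset.Icc (P.h i) (P.h' i)).filter fun r => P.lab i r ≠ 0 ∧ P.lab i r ≤ v).card = v := by
  obtain ⟨-, -, -, -, -, -, hmono⟩ := hP
  set T := (Finset.Icc (P.h i) (P.h' i)).filter fun r => P.lab i r ≠ 0 ∧ P.lab i r ≤ v with hT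
  have hinj : Set.InjOn (P.lab i) T := by
    intro a ha b hb hab
    simp only [hT, Finset.coe_filter, Finset.mem_Icc, Set.mem_ofPred_eq] at ha hb
    rcases lt_trichotomy a b with h | h | h
    · have := hmono i a b ha.1.1 h hb.1.2
      omega
    · exact h
    · have := hmono i b a hb.1.1 h ha.1.2
      omega
  have himg : T.image (P.lab i) ⊆ Finset.Icc 1 v := by
    intro u hu
    simp only [hT, Finset.mem_image, Finset.mem_filter, Finset.mem_Icc] at hu ⊢
    obtain ⟨r, hr, rfl⟩ := hu
    omega
  have hcomp : ((compSetS n k P i).filter fun u => u ≤ v) =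
      Finset.Icc 1 v \ T.image (P.lab i) := by
    ext u
    simp only [compSetS, hT, Finset.mem_filter, Finset.mem_Icc, Finset.mem_sdiff,
      Finset.mem_image, not_exists, not_and]
    constructor
    · rintro ⟨⟨⟨h1, -⟩, h3⟩, h4⟩
      exact ⟨⟨h1, h4⟩, fun r hr => h3 r hr.1.1 hr.1.2⟩
    · rintro ⟨⟨h1, h2⟩, h3⟩
      refine ⟨⟨⟨h1, h2.trans hv⟩, fun r hr hr' he => h3 r ⟨⟨hr, hr'⟩, ?_⟩ he⟩, h2⟩
      omega
  have hle := Finset.card_le_card himg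
  rw [hcomp, Finset.card_sdiff_of_subset himg, ← Finset.card_image_of_injOn hinj]
  rw [Nat.card_Icc] at hle ⊢
  omega

lemma card_compSetS_add_bS (hP : IsCompleteSD n k P) :
    (compSetS n k P i).card + bS P i = n - k := by
  rw [← card_compSetS_le_add_card (i := i) hP le_rfl]
  congr 1
  · congr 1
    ext u
    simp only [compSetS, Finset.mem_filter, Finset.mem_Icc]
    tauto
  · unfold bS
    congr 1
    ext r
    simp only [Finset.mem_filter, Finset.mem_Icc]
    have := hP.2.2.2.2.2.1 i r
    tauto

lemma h_le_top_zero_add_one (hP : IsCompleteSD n k P) : P.h i ≤ P.h' i - bS P i + 1 := by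
  have : bS P i ≤ (Finset.Icc (P.h i) (P.h' i)).card := Finset.card_filter_le _ _
  rw [Int.card_Icc] at this
  have := hP.1 i
  omega

lemma row_eq_compRowS_add (hP : IsCompleteSD n k P) {v : ℕ} (hv : v ≠ 0)
    (h₁ : P.h i ≤ r) (h₂ : r ≤ P.h' i) (hr : P.lab i r = v) :
    r = compRowS n k P i v + v := by
  have hvN : v ≤ n - k := hr ▸ hP.2.2.2.2.2.1 i r h₁ h₂
  have hcard := card_compSetS_le_add_card (i := i) hP hvN
  have hlt : ((compSetS n k P i).filter fun u => u ≤ v) =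
      (compSetS n k P i).filter fun u => u < v := by
    refine Finset.filter_congr fun u hu => ?_
    have : u ≠ v := by
      rintro rfl
      exact (Finset.mem_filter.1 hu).2 r h₁ h₂ hr
    omega
  have hrow : ((Finset.Icc (P.h i) (P.h' i)).filter fun s => P.lab i s ≠ 0 ∧ P.lab i s ≤ v) =
      Finset.Icc (max (P.h i) (P.h' i - bS P i + 1)) r := by
    ext s
    simp only [Finset.mem_filter, Finset.mem_Icc]
    constructor
    · rintro ⟨⟨h1, h2⟩, h3, h4⟩
      have := lab_eq_zero_iff hP h1 h2
      refine ⟨by omega, ?_⟩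
      by_contra hrs
      have := hP.2.2.2.2.2.2 i r s h₁ (by omega) h2
      omega
    · rintro ⟨h1, h2⟩
      have h3 : P.h i ≤ s := by omega
      have h4 : s ≤ P.h' i := by omega
      have := lab_eq_zero_iff hP h3 h4
      refine ⟨⟨h3, h4⟩, by omega, ?_⟩
      rcases eq_or_lt_of_le h2 with rfl | h
      · omega
      · have := hP.2.2.2.2.2.2 i s r h3 h h₂
        omega
  have hz := lab_eq_zero_iff hP h₁ h₂
  rw [hlt, hrow, max_eq_right (h_le_top_zero_add_one hP), Int.card_Icc] at hcard
  unfold compRowS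
  omega

end Column

/-- If a threshold `m` separates the elements of `S` of rank below `d` from the others, then
exactly `d` elements of `S` lie below `m`. -/
lemma card_filter_lt_eq_of_rank {S : Finset ℕ} {m d : ℕ} (hd : d ≤ S.card)
    (hlow : ∀ u ∈ S, (S.filter fun w => w < u).card < d → u < m)
    (hhigh : ∀ u ∈ S, d ≤ (S.filter fun w => w < u).card → m ≤ u) :
    (S.filter fun w => w < m).card = d := by
  rcases lt_trichotomy (S.filter fun w => w < m).card d with h | h | h
  · have hne : (S.filter fun w => ¬ w < m).Nonempty := by
      rw [← Finset.card_pos]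
      have := Finset.card_filter_add_card_filter_not (s := S) (fun w => w < m)
      omega
    obtain ⟨hu, hum⟩ := Finset.mem_filter.1 (Finset.min'_mem _ hne)
    have hle := fun w hw => Finset.min'_le (S.filter fun w => ¬ w < m) w hw
    set u := (S.filter fun w => ¬ w < m).min' hne
    refine absurd (hlow u hu (lt_of_le_of_lt (Finset.card_le_card fun w hw => ?_) h)) hum
    rw [Finset.mem_filter] at hw ⊢
    refine ⟨hw.1, ?_⟩
    by_contra hwm
    exact absurd (hle w (Finset.mem_filter.2 ⟨hw.1, hwm⟩)) (by omega)
  · exact h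
  · have hne : (S.filter fun w => w < m).Nonempty := by
      rw [← Finset.card_pos]
      omega
    obtain ⟨hu, hum⟩ := Finset.mem_filter.1 (Finset.max'_mem _ hne)
    have hle := fun w hw => Finset.le_max' (S.filter fun w => w < m) w hw
    have hmem := Finset.max'_mem _ hne
    set u := (S.filter fun w => w < m).max' hne
    have hcard : d ≤ (S.filter fun w => w < u).card := by
      have hsub : (S.filter fun w => w < m).erase u ⊆ S.filter fun w => w < u := by
        intro w hw
        rw [Finset.mem_erase] at hw
        have := hle w hw.2
        rw [Finset.mem_filter] at hw ⊢
        exact ⟨hw.2.1, by omega⟩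
      have := Finset.card_le_card hsub
      rw [Finset.card_erase_of_mem hmem] at this
      omega
    exact absurd (hhigh u hu hcard) (by omega)

/-- In a generalized shrunken fixed point, if the complement of column `i` contains `m` in row
`r₀`, then whether a column `j` to the right has the label `m` in row `r₀ + m - 1` depends only on
its number of labels. -/
lemma lab_eq_iff_of_mem_compSetS {n k : ℕ} {P : SDiag k} (hP : IsGSFP n k P) {i j : Fin k}
    (hij : i < j) {m : ℕ} (hm : m ∈ compSetS n k P i) :
    (occS P j (compRowS n k P i m + m - 1) ∧ P.lab j (compRowS n k P i m + m - 1) = m) ↔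
      compRowS n k P i m - 1 ≤ P.h' j - bS P j ∧ P.h' j - ((n : ℤ) - k) < compRowS n k P i m := by
  obtain ⟨hC, hfix⟩ := hP
  have hmN : 1 ≤ m ∧ m ≤ n - k := Finset.mem_Icc.1 (Finset.mem_filter.1 hm).1
  have hnmem : m ∉ compSetS n k P j := by
    intro hmj
    rcases lt_or_ge (compRowS n k P j m) (compRowS n k P i m) with h | h
    · exact lt_irrefl m (hfix i j m m hm hmj (Or.inl h))
    · rcases eq_or_lt_of_le h with h | h
      · exact lt_irrefl m (hfix j i m m hmj hm (Or.inr ⟨h.symm, hij⟩))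
      · exact lt_irrefl m (hfix j i m m hmj hm (Or.inl h))
  obtain ⟨r, hr1, hr2, hr⟩ : ∃ r, P.h j ≤ r ∧ r ≤ P.h' j ∧ P.lab j r = m := by
    by_contra hcon
    push Not at hcon
    exact hnmem (Finset.mem_filter.2 ⟨Finset.mem_Icc.2 hmN, hcon⟩)
  have hrow := row_eq_compRowS_add hC (by omega) hr1 hr2 hr
  have hcard := card_compSetS_add_bS (i := j) hC
  have hcle : ((compSetS n k P j).filter fun u => u < m).card ≤ (compSetS n k P j).card :=
    Finset.card_filter_le _ _
  have hdef : compRowS n k P j m =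
    P.h' j - bS P j - ((compSetS n k P j).filter fun u => u < m).card := rfl
  set R := compRowS n k P i m with hR
  constructor
  · rintro ⟨⟨h1, h2⟩, h3⟩
    have := row_eq_compRowS_add hC (by omega) h1 h2 h3
    omega
  · rintro ⟨h1, h2⟩
    have hc : ((compSetS n k P j).filter fun u => u < m).card =
        (P.h' j - bS P j - R + 1).toNat := by
      refine card_filter_lt_eq_of_rank (by omega) (fun u hu hlt => ?_) (fun u hu hge => ?_)
      · have hu' : compRowS n k P j u =
          P.h' j - bS P j - ((compSetS n k P j).filter fun w => w < u).card := rfl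
        have hle : R ≤ compRowS n k P j u := by omega
        refine hfix j i u m hu hm ?_
        rcases eq_or_lt_of_le hle with h | h
        · exact Or.inr ⟨h.symm, hij⟩
        · exact Or.inl h
      · have hu' : compRowS n k P j u =
          P.h' j - bS P j - ((compSetS n k P j).filter fun w => w < u).card := rfl
        exact (hfix i j m u hm hu (Or.inl (by omega))).le
    have hrR : r = R + m - 1 := by omega
    subst hrR
    exact ⟨⟨hr1, hr2⟩, hr⟩

/-- The contribution to `InvS` of the attacking pairs with first box in column `i` and second box
in column `j`. -/
def invPairs {k : ℕ} (P : SDiag k) (i j : Fin k) : ℕ :=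
  ((Finset.Icc (P.h i) (P.h' i)).filter fun r =>
    (i < j ∧ occS P j r ∧ P.lab i r < P.lab j r) ∨
    (j < i ∧ occS P j (r + 1) ∧ P.lab i r < P.lab j (r + 1))).card

lemma InvS_eq_sum_invPairs {k : ℕ} (P : SDiag k) : InvS P = ∑ i, ∑ j, invPairs P i j := rfl

lemma sum_sum_eq_sum_cross {ι : Type*} [Fintype ι] [DecidableEq ι] (D : ι → ι → ℤ) (a : ι)
    (hoff : ∀ i j, i ≠ a → j ≠ a → D i j = 0) (hdiag : D a a = 0) :
    ∑ i, ∑ j, D i j = ∑ j, (D a j + D j a) := by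
  have hrow : ∀ i, ∑ j, D i j = (if i = a then ∑ j, D a j else 0) + D i a := by
    intro i
    split_ifs with h
    · rw [h, hdiag, add_zero]
    · rw [zero_add]
      exact Finset.sum_eq_single a (fun j _ hj => hoff i j h hj) (by simp)
  rw [Finset.sum_congr rfl fun i _ => hrow i, Finset.sum_add_distrib, Finset.sum_add_distrib,
    Finset.sum_ite_eq' Finset.univ a fun _ => ∑ j, D a j, if_pos (Finset.mem_univ a)]

lemma sum_range_ite_telescope (φ : ℕ → ℤ) (a K : ℕ) :
    (∑ i ∈ Finset.range K, if a < i then φ (i + 1) - φ i else 0) =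
      if a < K then φ K - φ (a + 1) else 0 := by
  induction K with
  | zero => simp
  | succ K ih =>
    rw [Finset.sum_range_succ, ih]
    rcases lt_trichotomy a K with h | h | h
    · rw [if_pos h, if_pos h, if_pos (by omega)]
      ring
    · subst h
      simp
    · rw [if_neg (by omega), if_neg (by omega), if_neg (by omega)]
      simp

lemma InvS_eq_of_telescope {k : ℕ} {P Q : SDiag k} {a : Fin k} (φ : ℕ → ℤ)
    (hh : Q.h = P.h) (hh' : Q.h' = P.h') (hlab : ∀ j, j ≠ a → Q.lab j = P.lab j)
    (hlt : ∀ j, j < a →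
      invPairs Q a j = invPairs P a j ∧ invPairs Q j a = invPairs P j a)
    (hgt : ∀ j, a < j →
      (invPairs Q a j + invPairs Q j a : ℤ) - (invPairs P a j + invPairs P j a) =
        φ (j + 1) - φ j)
    (h₀ : φ (a + 1) = 0) (h₁ : φ k = 0) : InvS Q = InvS P := by
  have key : (InvS Q : ℤ) - InvS P = 0 := by
    simp only [InvS_eq_sum_invPairs, Nat.cast_sum, ← Finset.sum_sub_distrib]
    rw [sum_sum_eq_sum_cross (fun i j => (invPairs Q i j : ℤ) - invPairs P i j) a]
    · have hterm : ∀ j : Fin k, ((invPairs Q a j : ℤ) - invPairs P a j) +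
          ((invPairs Q j a : ℤ) - invPairs P j a) =
          if (a : ℕ) < (j : ℕ) then φ (j + 1) - φ j else 0 := by
        intro j
        rcases lt_trichotomy a j with h | h | h
        · rw [if_pos (Fin.lt_def.1 h), ← hgt j h]
          ring
        · subst h
          simp [invPairs]
        · rw [if_neg (by simpa using h.le), (hlt j h).1, (hlt j h).2]
          ring
      rw [Finset.sum_congr rfl fun j _ => hterm j,
        Fin.sum_univ_eq_sum_range (fun i : ℕ => if (a : ℕ) < i then φ (i + 1) - φ i else 0) k,
        sum_range_ite_telescope, if_pos a.2, h₀, h₁, sub_zero]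
    · intro i j hi hj
      rw [sub_eq_zero, Nat.cast_inj]
      unfold invPairs
      congr 1
      ext r
      simp only [Finset.mem_filter]
      simp only [occS, hh, hh', hlab i hi, hlab j hj]
    · simp [invPairs]
  omega

lemma card_filter_Icc_shift (p : ℤ → Prop) [DecidablePred p] {a b : ℤ} (hab : a ≤ b) :
    ((Finset.Icc (a + 1) b).filter p).card + (if p a then 1 else 0) =
      ((Finset.Icc a (b - 1)).filter p).card + (if p b then 1 else 0) := by
  have h₁ : Finset.Icc a b = insert a (Finset.Icc (a + 1) b) := by
    ext r
    simp only [Finset.mem_Icc, Finset.mem_insert]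
    omega
  have h₂ : Finset.Icc a b = insert b (Finset.Icc a (b - 1)) := by
    ext r
    simp only [Finset.mem_Icc, Finset.mem_insert]
    omega
  have e₁ : ((Finset.Icc a b).filter p).card =
      (if p a then 1 else 0) + ((Finset.Icc (a + 1) b).filter p).card := by
    rw [h₁, Finset.card_filter, Finset.sum_insert (by simp), Finset.card_filter]
  have e₂ : ((Finset.Icc a b).filter p).card =
      (if p b then 1 else 0) + ((Finset.Icc a (b - 1)).filter p).card := by
    rw [h₂, Finset.card_filter, Finset.sum_insert (by simp), Finset.card_filter]
  omega

lemma compSetS_congr {n k : ℕ} {P Q : SDiag k} {j : Fin k} (hh : Q.h = P.h) (hh' : Q.h' = P.h')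
    (hlab : Q.lab j = P.lab j) : compSetS n k Q j = compSetS n k P j := by
  unfold compSetS
  rw [hh, hh', hlab]

lemma compRowS_congr {n k : ℕ} {P Q : SDiag k} {j : Fin k} (hh : Q.h = P.h) (hh' : Q.h' = P.h')
    (hlab : Q.lab j = P.lab j) (v : ℕ) : compRowS n k Q j v = compRowS n k P j v := by
  unfold compRowS bS
  rw [compSetS_congr hh hh' hlab, hh, hh', hlab]

lemma IsGSFP.of_subset {n k : ℕ} {P Q : SDiag k} (hP : IsGSFP n k P) (hQ : IsCompleteSD n k Q)
    (h : ∀ i, ∀ v ∈ compSetS n k Q i,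
      v ∈ compSetS n k P i ∧ compRowS n k Q i v = compRowS n k P i v) : IsGSFP n k Q := by
  refine ⟨hQ, fun i i' v v' hv hv' hlt => ?_⟩
  rw [(h i v hv).2, (h i' v' hv').2] at hlt
  exact hP.2 i i' v v' (h i v hv).1 (h i' v' hv').1 hlt


/-- first reduction step: let `P` be a generalized shrunken fixed
point, `C = C_{i₀}` its leftmost non-basic column, and `m` the smallest element of
`{1, …, n-k}` not occurring among the labels of `C`.  Let `P'` be obtained from `P`
by removing the highest label `0` of column `C` (in row `r₀`), moving each of the
labels `1, …, m-1` down one row, and placing the label `m` in the row that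
contained `m - 1` (i.e. row `r₀ + m - 1`).  Then `P'` is again a generalized
shrunken fixed point and `Inv`, `pathdinv`, `maxInv` are unchanged. -/
theorem stmt6 (n k : ℕ) (hk : 1 ≤ k) (hnk : k < n) (P : SDiag k) (hP : IsGSFP n k P)
    (i₀ : Fin k)
    (hleft : ∀ j, j < i₀ → IsBasicCol n k P j) (hnb : ¬ IsBasicCol n k P i₀)
    (m : ℕ) (hm1 : 1 ≤ m) (hm2 : m ≤ n - k)
    (hmiss : ∀ r, P.h i₀ ≤ r → r ≤ P.h' i₀ → P.lab i₀ r ≠ m)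
    (hminimal : ∀ v, 1 ≤ v → v < m → ∃ r, P.h i₀ ≤ r ∧ r ≤ P.h' i₀ ∧ P.lab i₀ r = v)
    (r₀ : ℤ) (hr₀l : P.h i₀ ≤ r₀) (hr₀u : r₀ ≤ P.h' i₀) (hr₀0 : P.lab i₀ r₀ = 0)
    (hr₀top : ∀ r, r₀ < r → r ≤ P.h' i₀ → P.lab i₀ r ≠ 0)
    (P' : SDiag k) (hh : P'.h = P.h) (hh' : P'.h' = P.h')
    (hlabo : ∀ j, j ≠ i₀ → P'.lab j = P.lab j)
    (hlabC : ∀ r : ℤ, P'.lab i₀ r =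
      if r₀ ≤ r ∧ r < r₀ + (m : ℤ) - 1 then P.lab i₀ (r + 1)
      else if r = r₀ + (m : ℤ) - 1 then m
      else P.lab i₀ r) :
    IsGSFP n k P' ∧ InvS P' = InvS P ∧ pathdinvS n k P' = pathdinvS n k P ∧
      maxInvS P' = maxInvS P := by
  have hC := hP.1
  have hcol : P.h i₀ = 1 := by
    by_cases h0 : (i₀ : ℕ) = 0
    · have := hC.2.2.1 (by omega)
      rwa [← show i₀ = ⟨0, by omega⟩ from Fin.ext h0] at this
    · have hlt : (⟨(i₀ : ℕ) - 1, by omega⟩ : Fin k) < i₀ := Fin.lt_def.2 (by simp; omega)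
      have h1 := (hleft _ hlt).2.1
      have h2 := hC.2.2.2.2.1 ⟨(i₀ : ℕ) - 1, by omega⟩ (by simp; omega)
      rw [← show i₀ = ⟨(i₀ : ℕ) - 1 + 1, by omega⟩ from Fin.ext (by simp; omega)] at h2
      omega
  have hmem : m ∈ compSetS n k P i₀ :=
    Finset.mem_filter.2 ⟨Finset.mem_Icc.2 ⟨hm1, hm2⟩, hmiss⟩
  have hleast : ∀ u ∈ compSetS n k P i₀, m ≤ u := by
    intro u hu
    obtain ⟨hu1, hu2⟩ := Finset.mem_filter.1 hu
    by_contra hlt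
    obtain ⟨r, h1, h2, h3⟩ := hminimal u (Finset.mem_Icc.1 hu1).1 (by omega)
    exact hu2 r h1 h2 h3
  have hz : P.h' i₀ - bS P i₀ = r₀ := by
    have h1 := (lab_eq_zero_iff hC hr₀l hr₀u).1 hr₀0
    by_contra hne
    exact hr₀top (P.h' i₀ - bS P i₀) (by omega) (by omega)
      ((lab_eq_zero_iff hC (by omega) (by omega)).2 le_rfl)
  have hrow : ∀ v, v ≤ m → compRowS n k P i₀ v = r₀ := by
    intro v hv
    have : ((compSetS n k P i₀).filter fun u => u < v) = ∅ :=
      Finset.filter_eq_empty_iff.2 fun u hu => by have := hleast u hu; omega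
    unfold compRowS
    rw [this, hz]
    simp
  have hr₀2 : 2 ≤ r₀ := by
    have h1 := card_compSetS_add_bS (i := i₀) hC
    have h2 := Finset.card_pos.2 ⟨m, hmem⟩
    have h3 := hC.2.1 i₀
    omega
  have hin : ∀ r, r₀ ≤ r → r < r₀ + m → r ≤ P.h' i₀ ∧ (P.lab i₀ r : ℤ) = r - r₀ := by
    intro r h1 h2
    rcases eq_or_lt_of_le h1 with rfl | h1
    · exact ⟨hr₀u, by rw [hr₀0]; simp⟩
    · obtain ⟨s, hs1, hs2, hs3⟩ := hminimal (r - r₀).toNat (by omega) (by omega)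
      have hs := row_eq_compRowS_add hC (by omega) hs1 hs2 hs3
      rw [hrow _ (by omega)] at hs
      have : s = r := by omega
      subst this
      exact ⟨hs2, by omega⟩
  have hin' : ∀ r, r₀ ≤ r → r < r₀ + m → (P'.lab i₀ r : ℤ) = r - r₀ + 1 := by
    intro r h1 h2
    rw [hlabC]
    split_ifs with h3 h4
    · rw [(hin (r + 1) (by omega) (by omega)).2]
      ring
    · omega
    · omega
  have hout : ∀ r, ¬ (r₀ ≤ r ∧ r < r₀ + m) → P'.lab i₀ r = P.lab i₀ r := by
    intro r h
    rw [hlabC, if_neg (by omega), if_neg (by omega)]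
  have hlast := hin (r₀ + m - 1) (by omega) (by omega)
  have hC' : IsCompleteSD n k P' := by
    obtain ⟨c1, c2, c3, c4, c5, c6, c7⟩ := hC
    refine ⟨by rwa [hh, hh'], by rwa [hh'], by rwa [hh], by rwa [hh'], by rwa [hh, hh'], ?_, ?_⟩
    · rw [hh, hh']
      intro i r h1 h2
      by_cases hi : i = i₀
      · subst hi
        by_cases hr : r₀ ≤ r ∧ r < r₀ + m
        · have := hin' r hr.1 hr.2
          omega
        · rw [hout r hr]
          exact c6 i r h1 h2
      · rw [hlabo i hi]
        exact c6 i r h1 h2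
    · rw [hh, hh']
      intro i r r' h1 h2 h3
      by_cases hi : i = i₀
      · subst hi
        have hc := c7 i r r' h1 h2 h3
        by_cases hr : r₀ ≤ r ∧ r < r₀ + m
        · have e1 := hin' r hr.1 hr.2
          by_cases hr' : r₀ ≤ r' ∧ r' < r₀ + m
          · have e2 := hin' r' hr'.1 hr'.2
            omega
          · rw [hout r' hr']
            have e2 := c7 i (r₀ + m - 1) r' (by omega) (by omega) h3
            have e3 := hr₀top r' (by omega) h3
            have e4 := hmiss r' (by omega) h3
            omega
        · rw [hout r hr]
          by_cases hr' : r₀ ≤ r' ∧ r' < r₀ + m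
          · have e2 := hin' r' hr'.1 hr'.2
            have e3 := hin r' hr'.1 hr'.2
            omega
          · rw [hout r' hr']
            exact hc
      · rw [hlabo i hi]
        exact c7 i r r' h1 h2 h3
  have hz' : P'.h' i₀ - bS P' i₀ = r₀ - 1 := by
    have h1 := lab_eq_zero_iff (i := i₀) (r := r₀) hC' (by rwa [hh]) (by rwa [hh'])
    have h2 := lab_eq_zero_iff (i := i₀) (r := r₀ - 1) hC' (by rw [hh]; omega) (by rw [hh']; omega)
    have h3 := hin' r₀ le_rfl (by omega)
    have h4 := lab_eq_zero_iff (i := i₀) (r := r₀ - 1) hC (by omega) (by omega)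
    rw [hout (r₀ - 1) (by omega)] at h2
    omega
  refine ⟨hP.of_subset hC' ?_, ?_, ?_, ?_⟩
  · intro i v hv
    by_cases hi : i = i₀
    · subst hi
      have hcomp : compSetS n k P' i = (compSetS n k P i).erase m := by
        ext u
        simp only [compSetS, Finset.mem_filter, Finset.mem_erase, hh, hh']
        constructor
        · rintro ⟨h1, h2⟩
          refine ⟨?_, h1, fun r hr hr' he => ?_⟩
          · rintro rfl
            refine h2 (r₀ + u - 1) (by omega) hlast.1 ?_
            have := hin' (r₀ + u - 1) (by omega) (by omega)
            omega
          · have hu := (Finset.mem_Icc.1 h1).1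
            by_cases hrr : r₀ ≤ r ∧ r < r₀ + m
            · have e1 := hin r hrr.1 hrr.2
              have e2 := hin' (r - 1) (by omega) (by omega)
              exact h2 (r - 1) (by omega) (by omega) (by omega)
            · exact h2 r hr hr' (by rw [hout r hrr, he])
        · rintro ⟨h1, h2, h3⟩
          refine ⟨h2, fun r hr hr' he => ?_⟩
          by_cases hrr : r₀ ≤ r ∧ r < r₀ + m
          · have e1 := hin' r hrr.1 hrr.2
            have e2 := hin (r + 1)
            exact h3 (r + 1) (by omega) (by omega) (by omega)
          · exact h3 r hr hr' (by rw [← hout r hrr, he])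
      rw [hcomp, Finset.mem_erase] at hv
      refine ⟨hv.2, ?_⟩
      have hmv : m < v := lt_of_le_of_ne (hleast v hv.2) (Ne.symm hv.1)
      have hmf : m ∈ (compSetS n k P i).filter fun u => u < v := Finset.mem_filter.2 ⟨hmem, hmv⟩
      have hpos := Finset.card_pos.2 ⟨m, hmf⟩
      unfold compRowS
      rw [hz', hz, hcomp, Finset.filter_erase, Finset.card_erase_of_mem hmf]
      omega
    · rw [compSetS_congr hh hh' (hlabo i hi)] at hv
      exact ⟨hv, compRowS_congr hh hh' (hlabo i hi) v⟩
  · refine InvS_eq_of_telescope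
      (fun i => if h : i < k then (if r₀ ≤ P.h ⟨i, h⟩ then 1 else 0) else 0)
      hh hh' hlabo ?_ ?_ ?_ (by simp)
    · intro j hj
      obtain ⟨b1, b2, b3⟩ := hleft j hj
      have hlabj := hlabo j hj.ne
      constructor
      · unfold invPairs
        congr 1
        ext r
        simp only [Finset.mem_filter, Finset.mem_Icc, occS, hh, hh', hlabj, hj, hj.not_gt, b1, b2,
          false_and, true_and, false_or]
        have e1 := b3 (r + 1)
        by_cases hrr : r₀ ≤ r ∧ r < r₀ + m
        · have e2 := hin r hrr.1 hrr.2
          have e3 := hin' r hrr.1 hrr.2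
          omega
        · rw [hout r hrr]
      · unfold invPairs
        congr 1
        ext r
        simp only [Finset.mem_filter, Finset.mem_Icc, occS, hh, hh', hlabj, hj, hj.not_gt, b1, b2,
          false_and, true_and, or_false]
        have e1 := b3 r
        by_cases hrr : r₀ ≤ r ∧ r < r₀ + m
        · have e2 := hin r hrr.1 hrr.2
          have e3 := hin' r hrr.1 hrr.2
          omega
        · rw [hout r hrr]
    · intro j hj
      have hlabj := hlabo j hj.ne'
      set p : ℤ → Prop := fun r => occS P j r ∧ (P.lab j r : ℤ) = r - r₀ + 1 with hp
      have hleave : invPairs P i₀ j =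
          invPairs P' i₀ j + ((Finset.Icc (r₀ - 1 + 1) (r₀ + m - 1)).filter p).card := by
        unfold invPairs
        rw [← Finset.card_union_of_disjoint]
        · congr 1
          ext r
          simp only [Finset.mem_union, Finset.mem_filter, Finset.mem_Icc, occS, hh, hh', hlabj, hj,
            hj.not_gt, false_and, true_and, or_false, hp]
          by_cases hrr : r₀ ≤ r ∧ r < r₀ + m
          · have e2 := hin r hrr.1 hrr.2
            have e3 := hin' r hrr.1 hrr.2
            omega
          · rw [hout r hrr]
            omega
        · rw [Finset.disjoint_left]
          intro r
          simp only [Finset.mem_filter, Finset.mem_Icc, occS, hh, hh', hlabj, hj,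
            hj.not_gt, false_and, true_and, or_false, hp]
          intro h1 h2
          have e3 := hin' r (by omega) (by omega)
          omega
      have henter : invPairs P' j i₀ =
          invPairs P j i₀ + ((Finset.Icc (r₀ - 1) (r₀ + m - 1 - 1)).filter p).card := by
        unfold invPairs
        rw [← Finset.card_union_of_disjoint]
        · congr 1
          ext r
          simp only [Finset.mem_union, Finset.mem_filter, Finset.mem_Icc, occS, hh, hh', hlabj, hj,
            hj.not_gt, false_and, true_and, false_or, hp]
          by_cases hrr : r₀ ≤ r + 1 ∧ r + 1 < r₀ + m
          · have e2 := hin (r + 1) hrr.1 hrr.2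
            have e3 := hin' (r + 1) hrr.1 hrr.2
            omega
          · rw [hout (r + 1) hrr]
            omega
        · rw [Finset.disjoint_left]
          intro r
          simp only [Finset.mem_filter, Finset.mem_Icc, occS, hj,
            hj.not_gt, false_and, true_and, false_or, hp]
          intro h1 h2
          have e3 := hin (r + 1) (by omega) (by omega)
          omega
      have hshift := card_filter_Icc_shift p (a := r₀ - 1) (b := r₀ + m - 1) (by omega)
      have hA : p (r₀ - 1) ↔ P.h j ≤ r₀ - 1 ∧ r₀ - 1 ≤ P.h' j - bS P j := by
        simp only [hp, occS]
        constructor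
        · rintro ⟨⟨h1, h2⟩, h3⟩
          exact ⟨h1, (lab_eq_zero_iff hC h1 h2).1 (by omega)⟩
        · rintro ⟨h1, h2⟩
          have h3 : r₀ - 1 ≤ P.h' j := by omega
          have := (lab_eq_zero_iff hC h1 h3).2 h2
          exact ⟨⟨h1, h3⟩, by omega⟩
      have hB : p (r₀ + m - 1) ↔
          r₀ - 1 ≤ P.h' j - bS P j ∧ P.h' j - ((n : ℤ) - k) < r₀ := by
        have := lab_eq_iff_of_mem_compSetS hP hj hmem
        rw [hrow m le_rfl] at this
        rw [← this]
        simp only [hp]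
        refine and_congr_right fun _ => ?_
        omega
      have hbound := h_le_top_zero_add_one (i := j) hC
      have hcard := card_compSetS_add_bS (i := j) hC
      have hnext : (if h : (j : ℕ) + 1 < k then (if r₀ ≤ P.h ⟨j + 1, h⟩ then 1 else 0) else 0 : ℤ) =
          if r₀ ≤ P.h' j - ((n : ℤ) - k) then 1 else 0 := by
        split_ifs with h1 h2 h3 h4 h5
        · rfl
        · exact absurd (hC.2.2.2.2.1 j h1 ▸ h2) h3
        · exact absurd ((hC.2.2.2.2.1 j h1).symm ▸ h4) h2
        · rfl
        · have := hC.2.2.2.1 hk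
          rw [← show j = ⟨k - 1, by omega⟩ from Fin.ext (by simp; omega)] at this
          omega
        · rfl
      simp only [hnext, j.2, dif_pos, Fin.eta]
      simp only [hA, hB] at hshift
      split_ifs at hshift ⊢ <;> omega
    · split_ifs with h1 h2
      · have := hC.2.2.2.2.1 i₀ h1
        have h3 := card_compSetS_add_bS (i := i₀) hC
        have h4 := Finset.card_pos.2 ⟨m, hmem⟩
        omega
      · rfl
      · rfl
  · unfold pathdinvS
    rw [hh, hh']
  · unfold maxInvS occS
    rw [hh, hh']

end
end

section
/- Fix integers n > k ≥ 1 and K = k(n−k+1). The map F is a well-defined bijection from the union, over all (K,k) Dyck paths D and all admissible small tuples s for D, of the sets WPF(D,s), onto the set WLD^stack_{n,k} of word stacked parking functions. -/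
open scoped Classical
open Finset

noncomputable section

/-- A `(K, k)` Dyck path, encoded by cumulative column heights: `H i` is the number
of north steps taken before the `i`-th east step (equivalently, the number of north
steps in columns `0, …, i-1`), normalized so that `H i = K` for `i ≥ k`.  The path
runs from `(0,0)` to `(k, K)` and stays weakly above the line segment from `(0,0)`
to `(k, K)`. -/
def IsDyck (K k : ℕ) (H : ℕ → ℕ) : Prop :=
  H 0 = 0 ∧ Monotone H ∧ (∀ i, k ≤ i → H i = K) ∧ ∀ i, i ≤ k → K * i ≤ k * H i

/-- The labeled boxes of the path `H`: the boxes immediately to the right of its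
north steps (indexed by lower-left corners `(column, height)`). -/
def boxesD (K k : ℕ) (H : ℕ → ℕ) : Finset (ℕ × ℕ) :=
  (range k ×ˢ range K).filter fun B => H B.1 ≤ B.2 ∧ B.2 < H (B.1 + 1)

/-- The diagonal index of a box, for diagonals of slope `c = K / k`. -/
def diagIdx (c : ℕ) (B : ℕ × ℕ) : ℤ := (B.2 : ℤ) - (c : ℤ) * (B.1 : ℤ)

/-- `(A, B)` is an attacking (ordered) pair of boxes: `A` and `B` on the same
diagonal with `A` strictly to the left, or `A` one diagonal below `B` and strictly
to its right. -/
def Attack (c : ℕ) (A B : ℕ × ℕ) : Prop :=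
  (diagIdx c A = diagIdx c B ∧ A.1 < B.1) ∨
    (diagIdx c A = diagIdx c B - 1 ∧ B.1 < A.1)

/-- The attacking pairs among boxes of `S`. -/
def attackPairsOn (c : ℕ) (S : Finset (ℕ × ℕ)) : Finset ((ℕ × ℕ) × (ℕ × ℕ)) :=
  (S ×ˢ S).filter fun p => Attack c p.1 p.2

/-- The number of attacking pairs among boxes of `S` whose labels increase
(`tdinv`). -/
def tdinvOn (c : ℕ) (S : Finset (ℕ × ℕ)) (L : ℕ × ℕ → ℕ) : ℕ :=
  ((S ×ˢ S).filter fun p => Attack c p.1 p.2 ∧ L p.1 < L p.2).card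

/-- A word parking function of shape `H`: positive labels on the labeled boxes,
strictly increasing up each maximal run of north steps (= each column). -/
def IsWordPF (K k : ℕ) (H : ℕ → ℕ) (L : ℕ × ℕ → ℕ) : Prop :=
  (∀ B ∈ boxesD K k H, 1 ≤ L B) ∧
  ∀ i y, i < k → H i ≤ y → y + 1 < H (i + 1) → L (i, y) < L (i, y + 1)

/-- `maxtdinv` of the path `H`: the maximum of `tdinv` over all word parking
functions of shape `H`. -/
def maxtdinvD (c K k : ℕ) (H : ℕ → ℕ) : ℕ :=
  sSup {m : ℕ | ∃ L : ℕ × ℕ → ℕ, IsWordPF K k H L ∧ tdinvOn c (boxesD K k H) L = m}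

/-- The arm of a box strictly above the path: the number of boxes above the path
strictly to its right in its row. -/
def armD (k : ℕ) (H : ℕ → ℕ) (B : ℕ × ℕ) : ℕ :=
  ((Finset.Ioo B.1 k).filter fun j => H (j + 1) ≤ B.2).card

/-- The leg of a box strictly above the path: the number of boxes above the path
strictly below it in its column. -/
def legD (H : ℕ → ℕ) (B : ℕ × ℕ) : ℕ := B.2 - H (B.1 + 1)

/-- `pathdinv` of the path: the number of boxes `B` strictly above the path with
`arm B / (leg B + 1) ≤ k / K < (arm B + 1) / leg B`. -/
def pathdinvD (K k : ℕ) (H : ℕ → ℕ) : ℕ :=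
  ((range k ×ˢ range K).filter fun B =>
    H (B.1 + 1) ≤ B.2 ∧ armD k H B * K ≤ k * (legD H B + 1) ∧
      k * legD H B < (armD k H B + 1) * K).card

/-- A big tuple `b` for the path `H`: `b i` is at most the number of north steps in
column `i`, `∑ b i = K - n`, normalized by `b i = 0` for `i ≥ k`. -/
def IsBigTuple (n k : ℕ) (H b : ℕ → ℕ) : Prop :=
  (∀ i, i < k → b i ≤ H (i + 1) - H i) ∧
  (∑ i ∈ range k, b i = k * (n - k + 1) - n) ∧ ∀ i, k ≤ i → b i = 0

/-- Admissibility: `b i ≤ n - k` for all `i`. -/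
def AdmissibleB (n k : ℕ) (b : ℕ → ℕ) : Prop := ∀ i, i < k → b i ≤ n - k

/-- The big boxes of `(H, b)`: the top `b i` labeled boxes of column `i`. -/
def bigBoxes (K k : ℕ) (H b : ℕ → ℕ) : Finset (ℕ × ℕ) :=
  (range k ×ˢ range K).filter fun B =>
    H B.1 ≤ B.2 ∧ H (B.1 + 1) - b B.1 ≤ B.2 ∧ B.2 < H (B.1 + 1)

/-- The small boxes of `(H, b)`: the remaining labeled boxes. -/
def smallBoxes (K k : ℕ) (H b : ℕ → ℕ) : Finset (ℕ × ℕ) :=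
  (range k ×ˢ range K).filter fun B =>
    H B.1 ≤ B.2 ∧ B.2 < H (B.1 + 1) - b B.1

/-- The data of a candidate `(K, k)` rational parking function on small boxes:
a path `H`, a big tuple `b`, and a labeling `L` of the small boxes. -/
structure RatData where
  H : ℕ → ℕ
  b : ℕ → ℕ
  L : ℕ × ℕ → ℕ

/-- The data of a candidate word stacked parking function: stack column counts `w`,
a path `H` (cumulative column heights), and a labeling `L`. -/
structure StackData where
  w : ℕ → ℕ
  H : ℕ → ℕ
  L : ℕ × ℕ → ℕ

/-- A labeling of the small boxes of `(H, b)`: positive labels, strictly increasing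
up each column, normalized to `0` off the small boxes. -/
def IsSmallLab (K k : ℕ) (H b : ℕ → ℕ) (L : ℕ × ℕ → ℕ) : Prop :=
  (∀ B ∈ smallBoxes K k H b, 1 ≤ L B) ∧
  (∀ i y, i < k → H i ≤ y → y + 1 < H (i + 1) - b i → L (i, y) < L (i, y + 1)) ∧
  ∀ B, B ∉ smallBoxes K k H b → L B = 0

/-- An element of `WPF(D, s)` for some `(K, k)` Dyck path `D` and some admissible
small tuple `s` (equivalently, admissible big tuple `b`). -/
def IsRatPF (n k : ℕ) (P : RatData) : Prop :=
  IsDyck (k * (n - k + 1)) k P.H ∧ IsBigTuple n k P.H P.b ∧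
    AdmissibleB n k P.b ∧ IsSmallLab (k * (n - k + 1)) k P.H P.b P.L

/-- A word stacked parking function in the `n × k` grid: a stack with `w j ≥ 1`
boxes in column `j` (one stack box per row, at least one per column, each box
weakly right of the box below), a north-east path from `(0,0)` to `(k, n)` lying
weakly above all boxes of the stack, and positive labels on the boxes right of its
north steps, strictly increasing up each column; all data normalized outside the
grid. -/
def IsStackPF (n k : ℕ) (Q : StackData) : Prop :=
  (∀ j, j < k → 1 ≤ Q.w j) ∧ (∑ j ∈ range k, Q.w j = n) ∧ (∀ j, k ≤ j → Q.w j = 0) ∧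
  Q.H 0 = 0 ∧ Monotone Q.H ∧ (∀ j, k ≤ j → Q.H j = n) ∧
  (∀ j, j < k → (∑ t ∈ range (j + 1), Q.w t) ≤ Q.H (j + 1)) ∧
  (∀ B ∈ boxesD n k Q.H, 1 ≤ Q.L B) ∧
  (∀ j y, j < k → Q.H j ≤ y → y + 1 < Q.H (j + 1) → Q.L (j, y) < Q.L (j, y + 1)) ∧
  ∀ B, B ∉ boxesD n k Q.H → Q.L B = 0

/-- The cumulative column heights of the stacked path obtained by deleting the
north steps adjacent to big boxes: column `t` keeps `s t = v t - b t` north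
steps. -/
def stackH (k : ℕ) (H b : ℕ → ℕ) : ℕ → ℕ := fun j =>
  ∑ t ∈ range (min j k), (H (t + 1) - H t - b t)

/-- The map `F`: delete the north steps adjacent to big boxes (keeping the small
boxes with their labels) and take the stack with `w j = n - k + 1 - b j` boxes in
column `j`. -/
def Fmap (n k : ℕ) (P : RatData) : StackData where
  w := fun j => if j < k then n - k + 1 - P.b j else 0
  H := stackH k P.H P.b
  L := fun B =>
    if B.1 < k ∧ stackH k P.H P.b B.1 ≤ B.2 ∧ B.2 < stackH k P.H P.b (B.1 + 1) then
      P.L (B.1, B.2 + P.H B.1 - stackH k P.H P.b B.1)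
    else 0

theorem mem_boxesD_iff {K k : ℕ} {H : ℕ → ℕ} (hm : Monotone H) (hK : H k = K)
    (B : ℕ × ℕ) :
    B ∈ boxesD K k H ↔ B.1 < k ∧ H B.1 ≤ B.2 ∧ B.2 < H (B.1 + 1) := by
  simp only [boxesD, mem_filter, mem_product, mem_range]
  constructor
  · rintro ⟨⟨h1, -⟩, h2⟩
    exact ⟨h1, h2⟩
  · rintro ⟨h1, h2, h3⟩
    have := hm (show B.1 + 1 ≤ k from h1)
    exact ⟨⟨h1, by omega⟩, h2, h3⟩

theorem mem_smallBoxes_iff {K k : ℕ} {H : ℕ → ℕ} (b : ℕ → ℕ) (hm : Monotone H)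
    (hK : H k = K) (B : ℕ × ℕ) :
    B ∈ smallBoxes K k H b ↔ B.1 < k ∧ H B.1 ≤ B.2 ∧ B.2 < H (B.1 + 1) - b B.1 := by
  simp only [smallBoxes, mem_filter, mem_product, mem_range]
  constructor
  · rintro ⟨⟨h1, -⟩, h2⟩
    exact ⟨h1, h2⟩
  · rintro ⟨h1, h2, h3⟩
    have := hm (show B.1 + 1 ≤ k from h1)
    exact ⟨⟨h1, by omega⟩, h2, h3⟩

theorem le_mul_sub_add_one {n k : ℕ} (hk : 1 ≤ k) (hnk : k < n) :
    n ≤ k * (n - k + 1) := by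
  obtain ⟨d, rfl⟩ := Nat.exists_eq_add_of_lt hnk
  obtain ⟨m, rfl⟩ := Nat.exists_eq_add_of_le hk
  have : 1 + m + d + 1 - (1 + m) + 1 = d + 2 := by omega
  rw [this]
  nlinarith [Nat.zero_le (m * d)]

/-- The stacked path together with the partial sums of the big tuple recovers the path. -/
theorem stackH_add_sum {n k : ℕ} {H b : ℕ → ℕ} (hD : IsDyck (k * (n - k + 1)) k H)
    (hb : IsBigTuple n k H b) (j : ℕ) :
    stackH k H b j + ∑ t ∈ range j, b t = H j := by
  obtain ⟨h0, hm, hK, -⟩ := hD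
  obtain ⟨hb1, -, hb3⟩ := hb
  induction j with
  | zero => simp [stackH, h0]
  | succ j ih =>
    rw [sum_range_succ]
    by_cases hj : j < k
    · have h1 := hb1 j hj
      have h2 := hm (Nat.le_succ j)
      simp only [stackH, min_eq_left hj.le, min_eq_left (Nat.succ_le_of_lt hj),
        sum_range_succ] at ih ⊢
      simp only [Nat.succ_eq_add_one] at h2
      omega
    · push Not at hj
      simp only [stackH, min_eq_right hj, min_eq_right (hj.trans (Nat.le_succ j))] at ih ⊢
      rw [hb3 j hj, hK (j + 1) (by omega)]
      rw [hK j hj] at ih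
      omega

/-- The inverse of `Fmap`: reinsert `n - k + 1 - w j` north steps at the top of column `j`. -/
def unstack (n k : ℕ) (Q : StackData) : RatData where
  b := fun j => if j < k then n - k + 1 - Q.w j else 0
  H := fun j => Q.H j + ∑ t ∈ range j, if t < k then n - k + 1 - Q.w t else 0
  L := fun B =>
    if B.1 < k ∧ (Q.H B.1 + ∑ t ∈ range B.1, if t < k then n - k + 1 - Q.w t else 0) ≤ B.2 then
      Q.L (B.1, B.2 - ∑ t ∈ range B.1, if t < k then n - k + 1 - Q.w t else 0)
    else 0

theorem sum_big_add_sum_stack {n k : ℕ} {b w : ℕ → ℕ} {j : ℕ} (hj : j ≤ k)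
    (h : ∀ t, t < k → b t + w t = n - k + 1) :
    ∑ t ∈ range j, b t + ∑ t ∈ range j, w t = j * (n - k + 1) := by
  rw [← sum_add_distrib, sum_congr rfl fun t ht => h t (lt_of_lt_of_le (mem_range.1 ht) hj)]
  simp

/-- A column of a stack has at most `n - k + 1` boxes, as the others are nonempty. -/
theorem stack_width_le {n k : ℕ} {w : ℕ → ℕ} (hw1 : ∀ j, j < k → 1 ≤ w j)
    (hwn : ∑ j ∈ range k, w j = n) (t : ℕ) (ht : t < k) : w t ≤ n - k + 1 := by
  have h1 := add_sum_erase (range k) w (mem_range.2 ht)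
  have h2 : ((range k).erase t).card • 1 ≤ ∑ x ∈ (range k).erase t, w x :=
    card_nsmul_le_sum _ _ _ fun x hx => hw1 x (mem_range.1 (mem_of_mem_erase hx))
  rw [card_erase_of_mem (mem_range.2 ht), card_range, smul_eq_mul] at h2
  omega

theorem isStackPF_Fmap {n k : ℕ} (hk : 1 ≤ k) (hnk : k < n) {P : RatData}
    (hP : IsRatPF n k P) : IsStackPF n k (Fmap n k P) := by
  obtain ⟨hD, hb, ha, hL1, hL2, hL3⟩ := hP
  have key := stackH_add_sum hD hb
  obtain ⟨h0, hm, hK, hd⟩ := hD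
  obtain ⟨hb1, hb2, hb3⟩ := hb
  have hn := le_mul_sub_add_one hk hnk
  have hw : ∀ t, t < k → P.b t + (Fmap n k P).w t = n - k + 1 := fun t ht => by
    have := ha t ht
    simp only [Fmap, ht, if_true]
    omega
  have hstep : ∀ j, j < k → stackH k P.H P.b j ≤ stackH k P.H P.b (j + 1) := fun j hj => by
    have h1 := key j
    have h2 := key (j + 1)
    have h3 := hb1 j hj
    have h4 := hm (Nat.le_succ j)
    rw [sum_range_succ] at h2
    simp only [Nat.succ_eq_add_one] at h4
    omega
  have hend : ∀ j, k ≤ j → stackH k P.H P.b j = n := fun j hj => by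
    have h1 := key k
    rw [hb2, hK k le_rfl] at h1
    have h2 : stackH k P.H P.b j = stackH k P.H P.b k := by simp [stackH, hj]
    omega
  have hmono : Monotone (stackH k P.H P.b) := monotone_nat_of_le_succ fun j => by
    by_cases hj : j < k
    · exact hstep j hj
    · rw [hend j (by omega), hend (j + 1) (by omega)]
  have hmem := mem_boxesD_iff (K := n) hmono (hend k le_rfl)
  have hsmall := mem_smallBoxes_iff P.b hm (hK k le_rfl)
  have hcol : ∀ j, P.H (j + 1) - P.b j = stackH k P.H P.b (j + 1) + ∑ t ∈ range j, P.b t :=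
    fun j => by
      have h2 := key (j + 1)
      rw [sum_range_succ] at h2
      omega
  refine ⟨fun j hj => ?_, ?_, fun j hj => ?_, ?_, hmono, hend, fun j hj => ?_,
    fun B hB => ?_, fun j y hj hy hy' => ?_, fun B hB => ?_⟩
  · have := ha j hj
    simp only [Fmap, hj, if_true]
    omega
  · have := sum_big_add_sum_stack le_rfl hw
    omega
  · simp [Fmap, hj]
  · simp [Fmap, stackH]
  · have h1 := sum_big_add_sum_stack (show j + 1 ≤ k from hj) hw
    have h2 := key (j + 1)
    have h3 := hd (j + 1) hj
    rw [mul_assoc] at h3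
    have h4 := Nat.le_of_mul_le_mul_left h3 hk
    rw [mul_comm] at h4
    change _ ≤ stackH k P.H P.b (j + 1)
    omega
  · have hB' := (hmem B).1 hB
    simp only [Fmap, hB', and_self, if_true]
    refine hL1 _ ((hsmall _).2 ?_)
    have h1 := key B.1
    have h2 := hcol B.1
    refine ⟨hB'.1, ?_, ?_⟩ <;> simp only <;> omega
  · change stackH k P.H P.b j ≤ y at hy
    change y + 1 < stackH k P.H P.b (j + 1) at hy'
    have h1 := key j
    have h2 := hcol j
    simp only [Fmap]
    rw [if_pos ⟨hj, hy, by omega⟩, if_pos ⟨hj, by omega, hy'⟩,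
      show y + 1 + P.H j - stackH k P.H P.b j = y + P.H j - stackH k P.H P.b j + 1 by omega]
    exact hL2 j _ hj (by omega) (by omega)
  · exact if_neg fun h => hB ((hmem B).2 h)

theorem isRatPF_unstack {n k : ℕ} {Q : StackData}
    (hQ : IsStackPF n k Q) : IsRatPF n k (unstack n k Q) := by
  obtain ⟨hw1, hwn, hw0, h0, hm, hend, hs, hL1, hL2, hL3⟩ := hQ
  have hwle := stack_width_le hw1 hwn
  have hw : ∀ t, t < k → (unstack n k Q).b t + Q.w t = n - k + 1 := fun t ht => by
    have := hwle t ht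
    simp only [unstack, ht, if_true]
    omega
  have hb0 : ∀ t, k ≤ t → (unstack n k Q).b t = 0 := fun t ht => by simp [unstack, ht]
  have hbsum : ∑ t ∈ range k, (unstack n k Q).b t + n = k * (n - k + 1) := by
    have := sum_big_add_sum_stack le_rfl hw
    omega
  have hH : ∀ j, (unstack n k Q).H j = Q.H j + ∑ t ∈ range j, (unstack n k Q).b t :=
    fun j => rfl
  have hL : ∀ i y, (unstack n k Q).L (i, y) = if i < k ∧ (unstack n k Q).H i ≤ y then
      Q.L (i, y - ∑ t ∈ range i, (unstack n k Q).b t) else 0 := fun i y => rfl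
  generalize unstack n k Q = P at *
  have hm' : Monotone P.H := monotone_nat_of_le_succ fun j => by
    have := hm (Nat.le_succ j)
    rw [hH, hH, sum_range_succ]
    simp only [Nat.succ_eq_add_one] at this
    omega
  have hend' : ∀ j, k ≤ j → P.H j = k * (n - k + 1) := fun j hj => by
    induction j, hj using Nat.le_induction with
    | base => rw [hH, hend k le_rfl]; omega
    | succ j hj ih =>
      rw [hH, hend j hj] at ih
      rw [hH, hend (j + 1) (by omega), sum_range_succ, hb0 j hj]
      omega
  have hmem := mem_boxesD_iff (K := n) hm (hend k le_rfl)
  have hsmall := mem_smallBoxes_iff P.b hm' (hend' k le_rfl)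
  have hcol : ∀ j, P.H (j + 1) - P.b j = Q.H (j + 1) + ∑ t ∈ range j, P.b t := fun j => by
    rw [hH, sum_range_succ]
    omega
  refine ⟨⟨by simp [hH, h0], hm', hend', fun i hi => ?_⟩,
    ⟨fun i hi => ?_, by omega, hb0⟩, fun i hi => ?_, ?_, fun i y hi hy hy' => ?_, ?_⟩
  · rw [mul_assoc]
    refine Nat.mul_le_mul_left k ?_
    have h1 := sum_big_add_sum_stack hi hw
    rw [mul_comm, hH]
    rcases i with _ | i
    · simp
    · have := hs i hi
      omega
  · have := hm (Nat.le_succ i)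
    rw [hH, hH, sum_range_succ]
    simp only [Nat.succ_eq_add_one] at this
    omega
  · have h1 := hw i hi
    have h2 := hw1 i hi
    omega
  · rintro ⟨i, y⟩ hB
    obtain ⟨h1, h2, h3⟩ := (hsmall _).1 hB
    simp only at h1 h2 h3
    rw [hL, if_pos ⟨h1, h2⟩]
    rw [hcol] at h3
    rw [hH] at h2
    exact hL1 _ ((hmem _).2 ⟨h1, by simp only; omega, by simp only; omega⟩)
  · rw [hL, hL, if_pos ⟨hi, hy⟩, if_pos ⟨hi, by omega⟩]
    rw [hcol] at hy'
    rw [hH] at hy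
    rw [Nat.sub_add_comm (by omega)]
    exact hL2 i _ hi (by omega) (by omega)
  · rintro ⟨i, y⟩ hB
    rw [hL]
    split_ifs with h
    · refine hL3 _ fun hB' => hB ((hsmall _).2 ?_)
      have h3 := ((hmem _).1 hB').2.2
      have h2 := h.2
      simp only at h3
      rw [hH] at h2
      refine ⟨h.1, h.2, ?_⟩
      simp only
      rw [hcol]
      omega
    · rfl

theorem unstack_Fmap {n k : ℕ} {P : RatData} (hP : IsRatPF n k P) :
    unstack n k (Fmap n k P) = P := by
  obtain ⟨hD, hb, ha, -, -, hL3⟩ := hP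
  have key := stackH_add_sum hD hb
  have hbb : ∀ j, (if j < k then n - k + 1 - (Fmap n k P).w j else 0) = P.b j := fun j => by
    split_ifs with hj
    · have := ha j hj
      simp only [Fmap, hj, if_true]
      omega
    · exact (hb.2.2 j (by omega)).symm
  have hsmall := mem_smallBoxes_iff P.b hD.2.1 (hD.2.2.1 k le_rfl)
  have hH : ∀ j, (Fmap n k P).H j + ∑ t ∈ range j, P.b t = P.H j := key
  obtain ⟨H, b, L⟩ := P
  simp only [unstack, hbb, hH, RatData.mk.injEq, true_and]
  funext ⟨i, y⟩
  have h1 := key i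
  have h2 := key (i + 1)
  rw [sum_range_succ] at h2
  simp only [Fmap] at *
  by_cases hB : (i, y) ∈ smallBoxes (k * (n - k + 1)) k H b
  · obtain ⟨h3, h4, h5⟩ := (hsmall _).1 hB
    simp only at h3 h4 h5
    rw [if_pos ⟨h3, h4⟩, if_pos ⟨h3, by omega, by omega⟩]
    congr 2
    omega
  · rw [hL3 _ hB]
    split_ifs with h h'
    · exact absurd ((hsmall _).2 ⟨h.1, h.2, by simp only; omega⟩) hB
    · rfl
    · rfl

theorem Fmap_unstack {n k : ℕ} {Q : StackData} (hQ : IsStackPF n k Q) :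
    Fmap n k (unstack n k Q) = Q := by
  have hP := isRatPF_unstack hQ
  have key := stackH_add_sum hP.1 hP.2.1
  obtain ⟨hw1, hwn, hw0, h0, hm, hend, hs, hL1, hL2, hL3⟩ := hQ
  have hmem := mem_boxesD_iff (K := n) hm (hend k le_rfl)
  have hH : stackH k (unstack n k Q).H (unstack n k Q).b = Q.H := funext fun j => by
    have h1 := key j
    have h2 : (unstack n k Q).H j = Q.H j + ∑ t ∈ range j, (unstack n k Q).b t := rfl
    omega
  have hw : (fun j => if j < k then n - k + 1 - (unstack n k Q).b j else 0) = Q.w :=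
    funext fun j => by
      split_ifs with hj
      · have h1 := stack_width_le hw1 hwn j hj
        simp only [unstack, hj, if_true]
        omega
      · exact (hw0 j (by omega)).symm
  have hL : (Fmap n k (unstack n k Q)).L = Q.L := funext fun ⟨i, y⟩ => by
    have h2 : (unstack n k Q).H i = Q.H i + ∑ t ∈ range i, (unstack n k Q).b t := rfl
    simp only [Fmap, hH]
    split_ifs with h
    · have h3 : ∀ z, (unstack n k Q).L (i, z) = if i < k ∧ (unstack n k Q).H i ≤ z then
        Q.L (i, z - ∑ t ∈ range i, (unstack n k Q).b t) else 0 := fun z => rfl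
      rw [h3, if_pos ⟨h.1, by omega⟩]
      congr 2
      omega
    · exact (hL3 _ fun hB => h ((hmem _).1 hB)).symm
  obtain ⟨w, H, L⟩ := Q
  simp only [Fmap, StackData.mk.injEq]
  exact ⟨hw, hH, hL⟩

/-- `F` is a well-defined bijection from the union, over all `(K, k)`
Dyck paths `D` and all admissible small tuples `s` for `D`, of the sets
`WPF(D, s)`, onto the set of word stacked parking functions in the `n × k` grid. -/
theorem stmt8 (n k : ℕ) (hk : 1 ≤ k) (hnk : k < n) :
    Set.BijOn (Fmap n k) {P : RatData | IsRatPF n k P}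
      {Q : StackData | IsStackPF n k Q} := by
  exact Set.InvOn.bijOn (f' := unstack n k)
    ⟨fun _ hP => unstack_Fmap hP, fun _ hQ => Fmap_unstack hQ⟩
    (fun _ hP => isStackPF_Fmap hk hnk hP) (fun _ hQ => isRatPF_unstack hQ)

end
end

section
/- Fix integers n > k ≥ 1 and K = k(n−k+1). Let D be a (K,k) Dyck path with admissible small tuple s and big tuple b, let π ∈ WPF(D,s), and let A = (i,x) and B = (j,y) be two small labeled boxes of π (column index and height). Define F(A)' = (w_1+⋯+w_{i−1}+1, x − (b_1+⋯+b_{i−1})) and F(B)' = (w_1+⋯+w_{j−1}+1, y − (b_1+⋯+b_{j−1})), where w_i = n−k+1−b_i. Then (A,B) is an attacking pair in the K×k grid (with diagonals of slope K/k = n−k+1) if and only if (F(A)', F(B)') is an attacking pair in the n×n grid (with diagonals of slope 1). -/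
open scoped Classical
open Finset

noncomputable section

lemma sum_le_of_monotone {k : ℕ} {H b : ℕ → ℕ} (hH : Monotone H)
    (hb : ∀ i, i < k → b i ≤ H (i + 1) - H i) {i : ℕ} (hi : i ≤ k) :
    ∑ t ∈ range i, b t ≤ H i := by
  induction i with
  | zero => simp
  | succ i ih =>
    rw [sum_range_succ]
    have h₁ := ih (by omega)
    have h₂ := hb i (by omega)
    have h₃ := hH (Nat.le_succ i)
    simp only [Nat.succ_eq_add_one] at h₃
    omega

lemma sum_sub_add_sum {c k : ℕ} {b : ℕ → ℕ} (hb : ∀ i, i < k → b i ≤ c) {i : ℕ}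
    (hi : i ≤ k) : ∑ t ∈ range i, (c - b t) + ∑ t ∈ range i, b t = c * i := by
  rw [← sum_add_distrib, sum_congr rfl fun t ht =>
    Nat.sub_add_cancel (hb t (lt_of_lt_of_le (mem_range.1 ht) hi))]
  simp [mul_comm]

lemma sum_sub_lt_sum_sub {c k : ℕ} {b : ℕ → ℕ} (hb : ∀ i, i < k → b i < c) {i j : ℕ}
    (hj : j ≤ k) (hij : i < j) :
    ∑ t ∈ range i, (c - b t) < ∑ t ∈ range j, (c - b t) := by
  refine sum_lt_sum_of_subset (i := i) (range_subset_range.2 hij.le) (mem_range.2 hij)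
    (by simp) (Nat.sub_pos_of_lt (hb i (by omega))) fun _ _ _ => Nat.zero_le _

lemma sum_sub_lt_iff {c k : ℕ} {b : ℕ → ℕ} (hb : ∀ i, i < k → b i < c) {i j : ℕ}
    (hi : i ≤ k) (hj : j ≤ k) :
    ∑ t ∈ range i, (c - b t) < ∑ t ∈ range j, (c - b t) ↔ i < j := by
  refine ⟨fun h => ?_, sum_sub_lt_sum_sub hb hj⟩
  by_contra! hji
  rcases hji.eq_or_lt with rfl | hlt
  · exact h.false
  · exact h.asymm (sum_sub_lt_sum_sub hb hi hlt)

/-- The map on boxes preserves the diagonal index. -/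
lemma diagIdx_sub_sum {c k : ℕ} {H b : ℕ → ℕ} (hH : Monotone H)
    (hbH : ∀ i, i < k → b i ≤ H (i + 1) - H i) (hb : ∀ i, i < k → b i ≤ c)
    {B : ℕ × ℕ} (hB : B.1 ≤ k) (hHB : H B.1 ≤ B.2) :
    diagIdx 1 (∑ t ∈ range B.1, (c - b t), B.2 - ∑ t ∈ range B.1, b t) = diagIdx c B := by
  have h₁ := (sum_le_of_monotone hH hbH hB).trans hHB
  have h₂ := sum_sub_add_sum hb hB
  simp only [diagIdx]
  zify [h₁] at h₂ ⊢
  linarith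

/-- for small boxes `A = (i, x)` and `B = (j, y)` of
`π ∈ WPF(D, s)`, setting `F(A)' = (w_0 + ⋯ + w_{i-1}, x - (b_0 + ⋯ + b_{i-1}))`
(with `w t = n - k + 1 - b t`) and similarly for `F(B)'`, the pair `(A, B)` is
attacking in the `K × k` grid (diagonals of slope `n - k + 1`) if and only if
`(F(A)', F(B)')` is attacking in the `n × n` grid (diagonals of slope `1`). -/
theorem stmt10 (n k : ℕ) (hk : 1 ≤ k) (hnk : k < n) (P : RatData)
    (hP : IsRatPF n k P) (A B : ℕ × ℕ)
    (hA : A ∈ smallBoxes (k * (n - k + 1)) k P.H P.b)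
    (hB : B ∈ smallBoxes (k * (n - k + 1)) k P.H P.b) :
    Attack (n - k + 1) A B ↔
      Attack 1 ((∑ t ∈ range A.1, (n - k + 1 - P.b t)), A.2 - ∑ t ∈ range A.1, P.b t)
        ((∑ t ∈ range B.1, (n - k + 1 - P.b t)), B.2 - ∑ t ∈ range B.1, P.b t) := by
  obtain ⟨⟨-, hH, -, -⟩, ⟨hbH, -, -⟩, hadm, -⟩ := hP
  have hb : ∀ i, i < k → P.b i < n - k + 1 := fun i hi => Nat.lt_succ_of_le (hadm i hi)
  simp only [smallBoxes, mem_filter, mem_product, mem_range] at hA hB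
  obtain ⟨⟨hAk, -⟩, hHA, -⟩ := hA
  obtain ⟨⟨hBk, -⟩, hHB, -⟩ := hB
  simp only [Attack, diagIdx_sub_sum hH hbH (fun i hi => (hb i hi).le) hAk.le hHA,
    diagIdx_sub_sum hH hbH (fun i hi => (hb i hi).le) hBk.le hHB,
    sum_sub_lt_iff hb hAk.le hBk.le, sum_sub_lt_iff hb hBk.le hAk.le]

end
end
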